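/- arXiv:1307.3693 — 2 statements merged into one kernel-verified Lean document; each statement's English description precedes it below -/
import Mathlib

section
/- For all reals c > d > ε > 0 and every integer t₀ ≥ 0 there exist integers T₀ and n₀ such that the following holds. Suppose H is a 3-graph on n > n₀ vertices with δ₁(H) ≥ c·C(n,2). Then there exists an (ε,t)-regular partition Q of V(H) with t₀ < t < T₀ such that the cluster hypergraph K = K(ε,d,Q) has minimum vertex degree δ₁(K) ≥ (c − ε − d)·C(t,2). -/
/-- The degree of a vertex in a 3-graph: the number of edges containing it. -/
def hdeg {α : Type*} [DecidableEq α] (H : Finset (Finset α)) (v : α) : ℕ :=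
  (H.filter (fun e => v ∈ e)).card

/-- The number of edges of `H` with exactly one vertex in each of `A`, `B`, `C`
(for disjoint `A`, `B`, `C`). -/
def e3 {α : Type*} [DecidableEq α] (H : Finset (Finset α)) (A B C : Finset α) : ℕ :=
  (H.filter (fun e => ∃ a ∈ A, ∃ b ∈ B, ∃ c ∈ C, e = {a, b, c})).card

/-- The density of `H` with respect to the triple `(A, B, C)`. -/
noncomputable def dens {α : Type*} [DecidableEq α] (H : Finset (Finset α))
    (A B C : Finset α) : ℝ :=
  (e3 H A B C : ℝ) / ((A.card : ℝ) * (B.card : ℝ) * (C.card : ℝ))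

/-- The triple `(V₁, V₂, V₃)` of mutually disjoint vertex sets is `ε`-regular in `H`. -/
def EpsRegular {α : Type*} [DecidableEq α] (ε : ℝ) (H : Finset (Finset α))
    (V₁ V₂ V₃ : Finset α) : Prop :=
  ∀ A₁ ⊆ V₁, ∀ A₂ ⊆ V₂, ∀ A₃ ⊆ V₃,
    ε * (V₁.card : ℝ) ≤ (A₁.card : ℝ) → ε * (V₂.card : ℝ) ≤ (A₂.card : ℝ) →
    ε * (V₃.card : ℝ) ≤ (A₃.card : ℝ) →
    |dens H A₁ A₂ A₃ - dens H V₁ V₂ V₃| ≤ ε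

/-- The triple `(V₁, V₂, V₃)` is `(ε, d)`-regular in `H`. -/
def EpsDRegular {α : Type*} [DecidableEq α] (ε d : ℝ) (H : Finset (Finset α))
    (V₁ V₂ V₃ : Finset α) : Prop :=
  EpsRegular ε H V₁ V₂ V₃ ∧ d ≤ dens H V₁ V₂ V₃

section RegularityLemma

open Finset hiding dens

section CellAverage

variable {Ω κ κ' : Type*} [Fintype Ω] [DecidableEq κ] [DecidableEq κ']

/-- The average of `F` over the fibre of `g` through `ω`. -/
noncomputable def cellAvg (F : Ω → ℝ) (g : Ω → κ) (ω : Ω) : ℝ :=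
  (∑ ω' with g ω' = g ω, F ω') / (#{ω' | g ω' = g ω} : ℝ)

theorem cellAvg_congr (F : Ω → ℝ) (g : Ω → κ) {ω ω' : Ω} (h : g ω = g ω') :
    cellAvg F g ω = cellAvg F g ω' := by
  simp only [cellAvg, h]

theorem sum_cellAvg_mul (F : Ω → ℝ) (g : Ω → κ) (u : Ω → ℝ)
    (hu : ∀ ω ω', g ω = g ω' → u ω = u ω') :
    ∑ ω, cellAvg F g ω * u ω = ∑ ω, F ω * u ω := by
  have h1 : ∀ ω, cellAvg F g ω * u ω =
      ∑ ω', if g ω' = g ω then F ω' * u ω' / (#{z | g z = g ω'} : ℝ) else 0 := by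
    intro ω
    rw [cellAvg, div_mul_eq_mul_div, sum_mul, sum_div, sum_filter]
    refine sum_congr rfl fun ω' _ => ?_
    split_ifs with h
    · rw [hu _ _ h, h]
    · rfl
  simp_rw [h1]
  rw [sum_comm]
  refine sum_congr rfl fun ω' _ => ?_
  rw [← sum_filter, sum_const, nsmul_eq_mul]
  have hset : (univ.filter fun ω => g ω' = g ω) = univ.filter fun ω => g ω = g ω' := by
    ext; simp [eq_comm]
  rw [hset]
  have : (#{z | g z = g ω'} : ℝ) ≠ 0 := by
    have : 0 < #{z | g z = g ω'} := card_pos.2 ⟨ω', by simp⟩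
    positivity
  field_simp

theorem sum_cellAvg_of_saturated (F : Ω → ℝ) (g : Ω → κ) (S : Finset Ω)
    (hS : ∀ ω ω', g ω = g ω' → ω ∈ S → ω' ∈ S) :
    ∑ ω ∈ S, cellAvg F g ω = ∑ ω ∈ S, F ω := by
  classical
  have := sum_cellAvg_mul F g (fun ω => if ω ∈ S then 1 else 0) (by
    intro ω ω' h
    have : ω ∈ S ↔ ω' ∈ S := ⟨hS _ _ h, hS _ _ h.symm⟩
    simp [this])
  simpa using this

theorem sum_sq_cellAvg_of_refines (F : Ω → ℝ) (g : Ω → κ) (h : Ω → κ')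
    (hr : ∀ ω ω', h ω = h ω' → g ω = g ω') :
    ∑ ω, cellAvg F h ω ^ 2 =
      ∑ ω, cellAvg F g ω ^ 2 + ∑ ω, (cellAvg F h ω - cellAvg F g ω) ^ 2 := by
  have h1 := sum_cellAvg_mul F g (cellAvg F g) fun _ _ => cellAvg_congr F g
  have h2 := sum_cellAvg_mul F h (cellAvg F g) fun _ _ e => cellAvg_congr F g (hr _ _ e)
  have h3 : ∑ ω, (cellAvg F h ω - cellAvg F g ω) ^ 2 = ∑ ω, cellAvg F h ω ^ 2
      - 2 * ∑ ω, cellAvg F h ω * cellAvg F g ω + ∑ ω, cellAvg F g ω * cellAvg F g ω := by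
    rw [mul_sum, ← sum_sub_distrib, ← sum_add_distrib]
    exact sum_congr rfl fun _ _ => by ring
  have h4 : ∑ ω, cellAvg F g ω ^ 2 = ∑ ω, cellAvg F g ω * cellAvg F g ω :=
    sum_congr rfl fun _ _ => by ring
  linarith

theorem sum_sq_cellAvg_le (F : Ω → ℝ) (hF : ∀ ω, 0 ≤ F ω ∧ F ω ≤ 1) (g : Ω → κ) :
    ∑ ω, cellAvg F g ω ^ 2 ≤ Fintype.card Ω := by
  have : ∀ ω ∈ (univ : Finset Ω), cellAvg F g ω ^ 2 ≤ 1 := by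
    intro ω _
    have h0 : 0 ≤ cellAvg F g ω := div_nonneg (sum_nonneg fun _ _ => (hF _).1) (by positivity)
    have h1 : cellAvg F g ω ≤ 1 := by
      refine div_le_one_of_le₀ ?_ (by positivity)
      calc _ ≤ ∑ ω' with g ω' = g ω, (1 : ℝ) := sum_le_sum fun _ _ => (hF _).2
        _ = _ := by simp
    exact pow_le_one₀ h0 h1
  simpa using sum_le_sum this

end CellAverage

theorem exists_monochromatic_blocks {V κ : Type*} [DecidableEq V] [DecidableEq κ]
    (f : V → κ) (C : Finset κ) (hC : ∀ x, f x ∈ C) (m : ℕ) (hm : 0 < m) (S : Finset V) :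
    ∃ (t : ℕ) (P : Fin t → Finset V), (∀ i, P i ⊆ S) ∧ (∀ i, #(P i) = m) ∧
      (∀ i j, i ≠ j → Disjoint (P i) (P j)) ∧
      (∀ i, ∀ x ∈ P i, ∀ y ∈ P i, f x = f y) ∧ #S ≤ t * m + #C * m := by
  induction hn : #S using Nat.strong_induction_on generalizing S with
  | _ n ih =>
    subst hn
    by_cases hS : #S ≤ #C * m
    · exact ⟨0, Fin.elim0, fun i => i.elim0, fun i => i.elim0, fun i => i.elim0,
        fun i => i.elim0, by omega⟩
    · obtain ⟨y, -, hy⟩ := exists_lt_card_fiber_of_mul_lt_card_of_maps_to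
        (s := S) (t := C) (f := f) (n := m) (fun x _ => hC x) (by omega)
      obtain ⟨B, hBS, hBm⟩ := exists_subset_card_eq hy.le
      have hB : B ⊆ S := hBS.trans (filter_subset _ _)
      have hcard : #(S \ B) = #S - m := by rw [card_sdiff_of_subset hB, hBm]
      have hle : m ≤ #S := hBm ▸ card_le_card hB
      obtain ⟨t, P, h1, h2, h3, h4, h5⟩ := ih (#(S \ B)) (by omega) (S \ B) rfl
      have hdis : ∀ i, Disjoint B (P i) := fun i =>
        disjoint_of_subset_right (h1 i) disjoint_sdiff
      refine ⟨t + 1, Fin.cons B P, ?_, ?_, ?_, ?_, ?_⟩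
      · intro i
        refine Fin.cases hB (fun i => ?_) i
        simpa using (h1 i).trans sdiff_subset
      · intro i
        refine Fin.cases hBm (fun i => ?_) i
        simpa using h2 i
      · intro i j
        refine Fin.cases ?_ (fun i => ?_) i <;> refine Fin.cases ?_ (fun j => ?_) j
        · simp
        · intro _; simpa using hdis j
        · intro _; simpa using (hdis i).symm
        · intro h; simpa using h3 i j (by simpa using h)
      · intro i
        refine Fin.cases ?_ (fun i => ?_) i
        · intro x hx z hz
          have hx := (mem_filter.1 (hBS hx)).2
          have hz := (mem_filter.1 (hBS hz)).2
          rw [hx, hz]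
        · simpa using h4 i
      · rw [hcard] at h5
        have : (t + 1) * m = t * m + m := by ring
        omega

section Hypergraph

variable {V : Type*} [DecidableEq V]

/-- The indicator of the ordered triples that span an edge of `H`. -/
def edgeInd (H : Finset (Finset V)) (p : V × V × V) : ℝ :=
  if {p.1, p.2.1, p.2.2} ∈ H then 1 else 0

theorem edgeInd_nonneg (H : Finset (Finset V)) (p : V × V × V) : 0 ≤ edgeInd H p := by
  unfold edgeInd; split_ifs <;> norm_num

theorem edgeInd_le_one (H : Finset (Finset V)) (p : V × V × V) : edgeInd H p ≤ 1 := by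
  unfold edgeInd; split_ifs <;> norm_num

theorem e3_eq_sum_edgeInd (H : Finset (Finset V)) {A B C : Finset V} (hAB : Disjoint A B)
    (hAC : Disjoint A C) (hBC : Disjoint B C) :
    (e3 H A B C : ℝ) = ∑ p ∈ A ×ˢ B ×ˢ C, edgeInd H p := by
  simp only [edgeInd, sum_boole, e3]
  congr 1
  symm
  rw [disjoint_left] at hAB hAC hBC
  refine card_bij (fun p _ => {p.1, p.2.1, p.2.2}) ?_ ?_ ?_
  · rintro ⟨a, b, c⟩ h
    simp only [mem_filter, mem_product] at h ⊢
    exact ⟨h.2, a, h.1.1, b, h.1.2.1, c, h.1.2.2, rfl⟩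
  · rintro ⟨a, b, c⟩ h ⟨a', b', c'⟩ h' heq
    simp only [mem_filter, mem_product] at h h' heq
    obtain ⟨⟨ha, hb, hc⟩, -⟩ := h
    obtain ⟨⟨ha', hb', hc'⟩, -⟩ := h'
    have h1 : a ∈ ({a', b', c'} : Finset V) := heq ▸ by simp
    have h2 : b ∈ ({a', b', c'} : Finset V) := heq ▸ by simp
    have h3 : c ∈ ({a', b', c'} : Finset V) := heq ▸ by simp
    simp only [mem_insert, mem_singleton] at h1 h2 h3
    simp only [Prod.mk.injEq]
    grind
  · intro e he
    obtain ⟨he, a, ha, b, hb, c, hc, rfl⟩ := mem_filter.1 he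
    exact ⟨(a, b, c), by simp [*], rfl⟩

theorem dens_mul_card (H : Finset (Finset V)) {A B C : Finset V} (hAB : Disjoint A B)
    (hAC : Disjoint A C) (hBC : Disjoint B C) :
    dens H A B C * (#(A ×ˢ B ×ˢ C) : ℝ) = ∑ p ∈ A ×ˢ B ×ˢ C, edgeInd H p := by
  rw [← e3_eq_sum_edgeInd H hAB hAC hBC, dens]
  rw [card_product, card_product, Nat.cast_mul, Nat.cast_mul, ← mul_assoc (#A : ℝ)]
  refine div_mul_cancel_of_imp fun h => ?_
  have : ∀ S : Finset V, (#S : ℝ) = 0 → S = ∅ := fun S h => by simpa using h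
  simp only [mul_eq_zero] at h
  rcases h with (h | h) | h <;> simp [this _ h, e3]

/-- The ordered triples of distinct indices whose clusters do not form an `ε`-regular triple. -/
noncomputable def irregularTriples {ι : Type*} [Fintype ι] (ε : ℝ)
    (H : Finset (Finset V)) (P : ι → Finset V) : Finset (ι × ι × ι) :=
  open Classical in
  {q | q.1 ≠ q.2.1 ∧ q.1 ≠ q.2.2 ∧ q.2.1 ≠ q.2.2 ∧
    ¬ EpsRegular ε H (P q.1) (P q.2.1) (P q.2.2)}

/-- The members of `𝒜` containing each coordinate; its fibres are the products of three atoms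
of `𝒜`. -/
def atomTriple (𝒜 : Finset (Finset V)) (p : V × V × V) :
    Finset (Finset V) × Finset (Finset V) × Finset (Finset V) :=
  (𝒜.filter (p.1 ∈ ·), 𝒜.filter (p.2.1 ∈ ·), 𝒜.filter (p.2.2 ∈ ·))

theorem mem_iff_of_filter_eq {𝒜 : Finset (Finset V)} {x y : V}
    (h : 𝒜.filter (x ∈ ·) = 𝒜.filter (y ∈ ·)) {A : Finset V} (hA : A ∈ 𝒜) : x ∈ A ↔ y ∈ A := by
  have := congrArg (A ∈ ·) h
  simpa [hA] using this

theorem atomTriple_refines {𝒜 ℬ : Finset (Finset V)} (h : 𝒜 ⊆ ℬ) (p q : V × V × V)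
    (hpq : atomTriple ℬ p = atomTriple ℬ q) : atomTriple 𝒜 p = atomTriple 𝒜 q := by
  simp only [atomTriple, Prod.mk.injEq] at hpq ⊢
  refine ⟨?_, ?_, ?_⟩ <;> refine filter_congr fun A hA => mem_iff_of_filter_eq ?_ (h hA)
  exacts [hpq.1, hpq.2.1, hpq.2.2]

theorem product_saturated {𝒜 : Finset (Finset V)} {A B C : Finset V} (hA : A ∈ 𝒜)
    (hB : B ∈ 𝒜) (hC : C ∈ 𝒜) (p q : V × V × V) (hpq : atomTriple 𝒜 p = atomTriple 𝒜 q)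
    (hp : p ∈ A ×ˢ B ×ˢ C) : q ∈ A ×ˢ B ×ˢ C := by
  simp only [atomTriple, Prod.mk.injEq] at hpq
  simp only [mem_product] at hp ⊢
  exact ⟨(mem_iff_of_filter_eq hpq.1 hA).1 hp.1, (mem_iff_of_filter_eq hpq.2.1 hB).1 hp.2.1,
    (mem_iff_of_filter_eq hpq.2.2 hC).1 hp.2.2⟩

variable [Fintype V]

/-- The (unnormalised) energy of the partition of `V` into the atoms of `𝒜`. -/
noncomputable def atomEnergy (H 𝒜 : Finset (Finset V)) : ℝ :=
  ∑ p, cellAvg (edgeInd H) (atomTriple 𝒜) p ^ 2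

theorem atomEnergy_nonneg (H 𝒜 : Finset (Finset V)) : 0 ≤ atomEnergy H 𝒜 :=
  sum_nonneg fun _ _ => sq_nonneg _

theorem atomEnergy_le (H 𝒜 : Finset (Finset V)) : atomEnergy H 𝒜 ≤ (Fintype.card V : ℝ) ^ 3 := by
  refine (sum_sq_cellAvg_le _ (fun p => ⟨edgeInd_nonneg H p, edgeInd_le_one H p⟩) _).trans_eq ?_
  simp only [Fintype.card_prod]; push_cast; ring

theorem atomEnergy_mono (H : Finset (Finset V)) {𝒜 ℬ : Finset (Finset V)} (h : 𝒜 ⊆ ℬ) :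
    atomEnergy H 𝒜 ≤ atomEnergy H ℬ := by
  unfold atomEnergy
  rw [sum_sq_cellAvg_of_refines (edgeInd H) (atomTriple 𝒜) (atomTriple ℬ) (atomTriple_refines h)]
  exact le_add_of_nonneg_right (sum_nonneg fun _ _ => sq_nonneg _)

theorem sum_sq_sub_ge_of_witness (H : Finset (Finset V)) {𝒜 ℬ : Finset (Finset V)} {ε m : ℝ}
    (hε : 0 < ε) (hm : 0 < m) {X Y Z A B C : Finset V}
    (hXY : Disjoint X Y) (hXZ : Disjoint X Z) (hYZ : Disjoint Y Z)
    (hX : X ∈ 𝒜) (hY : Y ∈ 𝒜) (hZ : Z ∈ 𝒜)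
    (hXYZ : ∀ p ∈ X ×ˢ Y ×ˢ Z, ∀ q ∈ X ×ˢ Y ×ˢ Z, atomTriple 𝒜 p = atomTriple 𝒜 q)
    (hA : A ∈ ℬ) (hB : B ∈ ℬ) (hC : C ∈ ℬ) (hAX : A ⊆ X) (hBY : B ⊆ Y) (hCZ : C ⊆ Z)
    (hAm : ε * m ≤ #A) (hBm : ε * m ≤ #B) (hCm : ε * m ≤ #C)
    (hd : ε < |dens H A B C - dens H X Y Z|) :
    ε ^ 5 * m ^ 3 ≤ ∑ p ∈ A ×ˢ B ×ˢ C, (cellAvg (edgeInd H) (atomTriple ℬ) p -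
      cellAvg (edgeInd H) (atomTriple 𝒜) p) ^ 2 := by
  have hsub : A ×ˢ B ×ˢ C ⊆ X ×ˢ Y ×ˢ Z :=
    product_subset_product hAX (product_subset_product hBY hCZ)
  have hem : 0 < ε * m := by positivity
  have hcard : (ε * m) ^ 3 ≤ (#(A ×ˢ B ×ˢ C) : ℝ) := by
    simp only [card_product, Nat.cast_mul]
    calc (ε * m) ^ 3 = ε * m * (ε * m * (ε * m)) := by ring
      _ ≤ _ := by gcongr
  have hpos : 0 < (#(A ×ˢ B ×ˢ C) : ℝ) := lt_of_lt_of_le (by positivity) hcard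
  have havg : ∀ p ∈ X ×ˢ Y ×ˢ Z, cellAvg (edgeInd H) (atomTriple 𝒜) p = dens H X Y Z := by
    intro p hp
    have hfib : (univ.filter fun q => atomTriple 𝒜 q = atomTriple 𝒜 p) = X ×ˢ Y ×ˢ Z := by
      ext q
      simp only [mem_filter, mem_univ, true_and]
      exact ⟨fun h => product_saturated hX hY hZ p q h.symm hp, fun h => hXYZ q h p hp⟩
    have hne : (#(X ×ˢ Y ×ˢ Z) : ℝ) ≠ 0 := by
      have : 0 < #(X ×ˢ Y ×ˢ Z) := card_pos.2 ⟨p, hp⟩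
      positivity
    rw [cellAvg, hfib, ← dens_mul_card H hXY hXZ hYZ, mul_div_cancel_right₀ _ hne]
  have hsum : ∑ p ∈ A ×ˢ B ×ˢ C, (cellAvg (edgeInd H) (atomTriple ℬ) p -
      cellAvg (edgeInd H) (atomTriple 𝒜) p) =
      (dens H A B C - dens H X Y Z) * (#(A ×ˢ B ×ˢ C) : ℝ) := by
    rw [sum_sub_distrib, sum_cellAvg_of_saturated _ _ _ (product_saturated hA hB hC),
      sum_congr rfl fun p hp => havg p (hsub hp), sub_mul, sum_const, nsmul_eq_mul,
      dens_mul_card H (disjoint_of_subset_left hAX (disjoint_of_subset_right hBY hXY))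
        (disjoint_of_subset_left hAX (disjoint_of_subset_right hCZ hXZ))
        (disjoint_of_subset_left hBY (disjoint_of_subset_right hCZ hYZ))]
    ring
  have hcs := sq_sum_le_card_mul_sum_sq (s := A ×ˢ B ×ˢ C)
    (f := fun p => cellAvg (edgeInd H) (atomTriple ℬ) p - cellAvg (edgeInd H) (atomTriple 𝒜) p)
  rw [hsum] at hcs
  have hsq : ε ^ 2 ≤ (dens H A B C - dens H X Y Z) ^ 2 := by
    rw [← sq_abs (dens H A B C - dens H X Y Z)]
    gcongr
  have : ε ^ 2 * (#(A ×ˢ B ×ˢ C) : ℝ) ≤ ∑ p ∈ A ×ˢ B ×ˢ C,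
      (cellAvg (edgeInd H) (atomTriple ℬ) p - cellAvg (edgeInd H) (atomTriple 𝒜) p) ^ 2 := by
    refine le_of_mul_le_mul_left (le_trans ?_ hcs) hpos
    rw [mul_pow]
    nlinarith [mul_le_mul_of_nonneg_right hsq (sq_nonneg (#(A ×ˢ B ×ˢ C) : ℝ))]
  refine le_trans ?_ this
  calc ε ^ 5 * m ^ 3 = ε ^ 2 * (ε * m) ^ 3 := by ring
    _ ≤ _ := by gcongr

theorem exists_atomEnergy_increment {t m : ℕ} {ε : ℝ} (hε : 0 < ε) (hm : 0 < m)
    (H 𝒜 : Finset (Finset V)) (P : Fin t → Finset V) (hPm : ∀ i, #(P i) = m)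
    (hP : ∀ i j, i ≠ j → Disjoint (P i) (P j))
    (hmono : ∀ i, ∀ x ∈ P i, ∀ y ∈ P i, 𝒜.filter (x ∈ ·) = 𝒜.filter (y ∈ ·)) :
    ∃ ℬ : Finset (Finset V), #ℬ ≤ #𝒜 + t + 3 * t ^ 3 ∧
      atomEnergy H 𝒜 + #(irregularTriples ε H P) * (ε ^ 5 * m ^ 3) ≤ atomEnergy H ℬ := by
  have hwit : ∀ q : Fin t × Fin t × Fin t, ∃ A B C : Finset V, q ∈ irregularTriples ε H P →
      A ⊆ P q.1 ∧ B ⊆ P q.2.1 ∧ C ⊆ P q.2.2 ∧ ε * m ≤ #A ∧ ε * m ≤ #B ∧ ε * m ≤ #C ∧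
      ε < |dens H A B C - dens H (P q.1) (P q.2.1) (P q.2.2)| := by
    intro q
    by_cases hq : q ∈ irregularTriples ε H P
    · have := hq
      simp only [irregularTriples, mem_filter, EpsRegular, not_forall, not_le, hPm] at this
      obtain ⟨-, -, -, -, A, hA, B, hB, C, hC, h1, h2, h3, h4⟩ := this
      exact ⟨A, B, C, fun _ => ⟨hA, hB, hC, h1, h2, h3, h4⟩⟩
    · exact ⟨∅, ∅, ∅, fun h => absurd h hq⟩
  choose A B C hABC using hwit
  set 𝒬 : Finset (Finset V) := 𝒜 ∪ univ.image P with h𝒬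
  set ℬ : Finset (Finset V) := 𝒬 ∪ (univ.image A ∪ (univ.image B ∪ univ.image C)) with hℬ
  have h𝒬ℬ : 𝒬 ⊆ ℬ := subset_union_left
  have hP𝒬 : ∀ i, P i ∈ 𝒬 := fun i => mem_union_right _ (mem_image_of_mem _ (mem_univ _))
  refine ⟨ℬ, ?_, ?_⟩
  · have h1 : #(univ.image P) ≤ t := card_image_le.trans_eq (by simp)
    have h2 : ∀ D : Fin t × Fin t × Fin t → Finset V, #(univ.image D) ≤ t ^ 3 := fun D =>
      card_image_le.trans_eq (by simp only [card_univ, Fintype.card_prod, Fintype.card_fin]; ring)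
    have h3 : #ℬ ≤ #𝒬 + #(univ.image A ∪ (univ.image B ∪ univ.image C)) := card_union_le _ _
    have h4 : #𝒬 ≤ #𝒜 + #(univ.image P) := card_union_le _ _
    have := card_union_le (univ.image A) (univ.image B ∪ univ.image C)
    have := card_union_le (univ.image B) (univ.image C)
    have := h2 A
    have := h2 B
    have := h2 C
    omega
  · have hcell : ∀ i, ∀ x ∈ P i, ∀ y ∈ P i, 𝒬.filter (x ∈ ·) = 𝒬.filter (y ∈ ·) := by
      intro i x hx y hy
      refine filter_congr fun D hD => ?_
      rcases mem_union.1 hD with hD | hD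
      · exact mem_iff_of_filter_eq (hmono i x hx y hy) hD
      · obtain ⟨j, -, rfl⟩ := mem_image.1 hD
        by_cases hij : i = j
        · subst hij; simp [hx, hy]
        · have := disjoint_left.1 (hP i j hij)
          simp [this hx, this hy]
    have hstep : atomEnergy H ℬ = atomEnergy H 𝒬 + _ :=
      sum_sq_cellAvg_of_refines (edgeInd H) (atomTriple 𝒬) (atomTriple ℬ) (atomTriple_refines h𝒬ℬ)
    rw [hstep]
    refine add_le_add (atomEnergy_mono H subset_union_left) ?_
    have hdis : Set.PairwiseDisjoint (irregularTriples ε H P : Set (Fin t × Fin t × Fin t))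
        fun q => A q ×ˢ B q ×ˢ C q := by
      intro q hq q' hq' hne
      rw [Function.onFun, disjoint_left]
      rintro ⟨x, y, z⟩ h h'
      simp only [mem_product] at h h'
      obtain ⟨a1, a2, a3, -⟩ := hABC q hq
      obtain ⟨b1, b2, b3, -⟩ := hABC q' hq'
      have key : ∀ i j x, x ∈ P i → x ∈ P j → i = j := fun i j x hi hj => by
        by_contra hij
        exact disjoint_left.1 (hP i j hij) hi hj
      exact hne (Prod.ext (key _ _ x (a1 h.1) (b1 h'.1))
        (Prod.ext (key _ _ y (a2 h.2.1) (b2 h'.2.1)) (key _ _ z (a3 h.2.2) (b3 h'.2.2))))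
    calc (#(irregularTriples ε H P) : ℝ) * (ε ^ 5 * m ^ 3)
        = ∑ q ∈ irregularTriples ε H P, ε ^ 5 * (m : ℝ) ^ 3 := by simp
      _ ≤ ∑ q ∈ irregularTriples ε H P, ∑ p ∈ A q ×ˢ B q ×ˢ C q,
          (cellAvg (edgeInd H) (atomTriple ℬ) p - cellAvg (edgeInd H) (atomTriple 𝒬) p) ^ 2 := by
          refine sum_le_sum fun q hq => ?_
          have hmemℬ : A q ∈ ℬ ∧ B q ∈ ℬ ∧ C q ∈ ℬ := by simp [hℬ]
          obtain ⟨a1, a2, a3, c1, c2, c3, hd⟩ := hABC q hq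
          simp only [irregularTriples, mem_filter] at hq
          refine sum_sq_sub_ge_of_witness H hε (by exact_mod_cast hm) (hP _ _ hq.2.1)
            (hP _ _ hq.2.2.1) (hP _ _ hq.2.2.2.1) (hP𝒬 _) (hP𝒬 _) (hP𝒬 _) ?_
            hmemℬ.1 hmemℬ.2.1 hmemℬ.2.2 a1 a2 a3 c1 c2 c3 hd
          intro p hp p' hp'
          simp only [mem_product] at hp hp'
          simp only [atomTriple, Prod.mk.injEq]
          exact ⟨hcell _ _ hp.1 _ hp'.1, hcell _ _ hp.2.1 _ hp'.2.1, hcell _ _ hp.2.2 _ hp'.2.2⟩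
      _ ≤ _ := by
          rw [← sum_biUnion hdis]
          exact sum_le_sum_of_subset_of_nonneg (subset_univ _) fun _ _ _ => sq_nonneg _

end Hypergraph

theorem card_biUnion_blocks {V : Type*} [DecidableEq V] {t m : ℕ} {P : Fin t → Finset V}
    (hPm : ∀ i, #(P i) = m) (hP : ∀ i j, i ≠ j → Disjoint (P i) (P j)) :
    #(univ.biUnion P) = t * m := by
  rw [card_biUnion fun i _ j _ h => hP i j h]
  simp [hPm]

theorem card_blocks_le {V : Type*} [Fintype V] [DecidableEq V] {t m : ℕ} {P : Fin t → Finset V}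
    (hPm : ∀ i, #(P i) = m) (hP : ∀ i j, i ≠ j → Disjoint (P i) (P j)) :
    t * m ≤ Fintype.card V := by
  rw [← card_biUnion_blocks hPm hP]
  exact card_le_univ _

theorem exists_regular_blocks_or_increment {ε η β : ℝ} (hε : 0 < ε) (hη : 0 < η) (hβ : 0 < β)
    (hβ' : β ≤ 1 / 2) (M : ℕ) :
    ∃ T n₀ M' : ℕ, M ≤ M' ∧ ∀ n : ℕ, n > n₀ → ∀ H 𝒜 : Finset (Finset (Fin n)), #𝒜 ≤ M →
      (∃ (t m : ℕ) (P : Fin t → Finset (Fin n)), M < t ∧ t < T ∧ 0 < m ∧ (∀ i, #(P i) = m) ∧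
        (∀ i j, i ≠ j → Disjoint (P i) (P j)) ∧ (1 - β) * n ≤ t * m ∧
        #(irregularTriples ε H P) ≤ η * (t : ℝ) ^ 3) ∨
      ∃ ℬ : Finset (Finset (Fin n)), #ℬ ≤ M' ∧
        atomEnergy H 𝒜 + η * ε ^ 5 / 8 * (n : ℝ) ^ 3 ≤ atomEnergy H ℬ := by
  set N : ℕ := 2 ^ M with hN
  have hN0 : (0 : ℝ) < N := by rw [hN]; positivity
  set T : ℕ := ⌈2 * N / β⌉₊ + 1 with hT
  refine ⟨T, ⌈N / β⌉₊, M + T + 3 * T ^ 3, by omega, fun n hn H 𝒜 h𝒜 => ?_⟩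
  have hn' : N / β < n := (Nat.le_ceil _).trans_lt (by exact_mod_cast hn)
  have hn1 : 1 ≤ β * n / N := by
    rw [div_lt_iff₀ hβ] at hn'
    rw [le_div_iff₀ hN0]; linarith
  set m : ℕ := ⌊β * n / N⌋₊ with hm
  have hm1 : 1 ≤ m := (Nat.one_le_floor_iff _).2 hn1
  have hmle : (N : ℝ) * m ≤ β * n := by
    have : (m : ℝ) ≤ β * n / N := Nat.floor_le (by positivity)
    rw [le_div_iff₀ hN0] at this; linarith
  have hmge : β * n ≤ 2 * N * m := by
    have h1 : β * n / N < m + 1 := Nat.lt_floor_add_one _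
    have h2 : (1 : ℝ) ≤ m := by exact_mod_cast hm1
    rw [div_lt_iff₀ hN0] at h1
    nlinarith
  obtain ⟨t, P, -, hPm, hP, hmono, hcov⟩ := exists_monochromatic_blocks
    (fun x : Fin n => 𝒜.filter (x ∈ ·)) 𝒜.powerset (fun x => by simp) m hm1 univ
  have hn0 : (0 : ℝ) < n := lt_of_le_of_lt (by positivity) hn'
  have hm0 : (0 : ℝ) < m := by exact_mod_cast hm1
  have hcov' : (1 - β) * n ≤ t * m := by
    have h1 : #𝒜.powerset ≤ N := by
      rw [card_powerset, hN]; exact Nat.pow_le_pow_right (by norm_num) h𝒜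
    have h2 : n ≤ t * m + N * m := by
      have := Nat.mul_le_mul_right m h1
      simp only [card_univ, Fintype.card_fin] at hcov
      omega
    have h3 : (n : ℝ) ≤ t * m + N * m := by exact_mod_cast h2
    linarith
  have htm : (t : ℝ) * m ≤ n := by
    have := card_blocks_le hPm hP
    rw [Fintype.card_fin] at this
    exact_mod_cast this
  have hhalf : (n : ℝ) / 2 ≤ t * m := by nlinarith
  have htM : M < t := by
    have h1 : (N : ℝ) ≤ t := by
      refine le_of_mul_le_mul_right ?_ hm0
      nlinarith
    have h2 : N ≤ t := by exact_mod_cast h1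
    exact (Nat.lt_two_pow_self (n := M)).trans_le h2
  have htT : t < T := by
    have h1 : (t : ℝ) ≤ 2 * N / β := by
      rw [le_div_iff₀ hβ]
      refine le_of_mul_le_mul_right ?_ hm0
      nlinarith
    have h2 : (t : ℝ) ≤ ⌈2 * N / β⌉₊ := h1.trans (Nat.le_ceil _)
    have h3 : t ≤ ⌈2 * N / β⌉₊ := by exact_mod_cast h2
    omega
  by_cases hirr : #(irregularTriples ε H P) ≤ η * (t : ℝ) ^ 3
  · exact Or.inl ⟨t, m, P, htM, htT, hm1, hPm, hP, hcov', hirr⟩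
  · right
    obtain ⟨ℬ, hℬ, hE⟩ := exists_atomEnergy_increment hε hm1 H 𝒜 P hPm hP hmono
    refine ⟨ℬ, ?_, le_trans (add_le_add_right ?_ _) hE⟩
    · have := Nat.pow_le_pow_left htT.le 3
      omega
    · have h1 : ((n : ℝ) / 2) ^ 3 ≤ (t * m) ^ 3 := by gcongr
      calc η * ε ^ 5 / 8 * (n : ℝ) ^ 3 = η * ε ^ 5 * ((n : ℝ) / 2) ^ 3 := by ring
        _ ≤ η * ε ^ 5 * (t * m) ^ 3 := by gcongr
        _ = (η * (t : ℝ) ^ 3) * (ε ^ 5 * m ^ 3) := by ring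
        _ ≤ _ := by gcongr; exact (not_le.1 hirr).le

/-- Weak regularity lemma for 3-graphs. -/
theorem exists_regular_blocks {ε η β : ℝ} (hε : 0 < ε) (hη : 0 < η) (hβ : 0 < β)
    (hβ' : β ≤ 1 / 2) (t₀ : ℕ) :
    ∃ T n₀ : ℕ, ∀ n : ℕ, n > n₀ → ∀ H : Finset (Finset (Fin n)),
      ∃ (t m : ℕ) (P : Fin t → Finset (Fin n)), t₀ < t ∧ t < T ∧ 0 < m ∧ (∀ i, #(P i) = m) ∧
        (∀ i j, i ≠ j → Disjoint (P i) (P j)) ∧ (1 - β) * n ≤ t * m ∧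
        #(irregularTriples ε H P) ≤ η * (t : ℝ) ^ 3 := by
  set γ : ℝ := η * ε ^ 5 / 8 with hγ
  have hγ0 : 0 < γ := by positivity
  have iter : ∀ J : ℕ, ∃ T n₀ M : ℕ, t₀ ≤ M ∧ ∀ n : ℕ, n > n₀ → ∀ H : Finset (Finset (Fin n)),
      (∃ (t m : ℕ) (P : Fin t → Finset (Fin n)), t₀ < t ∧ t < T ∧ 0 < m ∧ (∀ i, #(P i) = m) ∧
        (∀ i j, i ≠ j → Disjoint (P i) (P j)) ∧ (1 - β) * n ≤ t * m ∧
        #(irregularTriples ε H P) ≤ η * (t : ℝ) ^ 3) ∨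
      ∃ 𝒜 : Finset (Finset (Fin n)), #𝒜 ≤ M ∧ J * (γ * (n : ℝ) ^ 3) ≤ atomEnergy H 𝒜 := by
    intro J
    induction J with
    | zero =>
      exact ⟨0, 0, t₀, le_rfl, fun n _ H => Or.inr ⟨∅, by simp, by
        simpa using atomEnergy_nonneg H ∅⟩⟩
    | succ J ih =>
      obtain ⟨T, n₀, M, hM, h⟩ := ih
      obtain ⟨T', n₀', M', hM', h'⟩ := exists_regular_blocks_or_increment hε hη hβ hβ' M
      refine ⟨max T T', max n₀ n₀', M', hM.trans hM', fun n hn H => ?_⟩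
      rcases h n (lt_of_le_of_lt (le_max_left _ _) hn) H with
        ⟨t, m, P, h1, h2, h3⟩ | ⟨𝒜, h𝒜, hE⟩
      · exact Or.inl ⟨t, m, P, h1, lt_max_of_lt_left h2, h3⟩
      · rcases h' n (lt_of_le_of_lt (le_max_right _ _) hn) H 𝒜 h𝒜 with
          ⟨t, m, P, h1, h2, h3⟩ | ⟨ℬ, hℬ, hE'⟩
        · exact Or.inl ⟨t, m, P, hM.trans_lt h1, lt_max_of_lt_right h2, h3⟩
        · refine Or.inr ⟨ℬ, hℬ, ?_⟩
          rw [← hγ] at hE'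
          push_cast
          linarith
  obtain ⟨J, hJ⟩ := exists_nat_gt (1 / γ)
  obtain ⟨T, n₀, M, -, h⟩ := iter J
  refine ⟨T, n₀, fun n hn H => ?_⟩
  rcases h n hn H with h | ⟨𝒜, -, hE⟩
  · exact h
  · exfalso
    have hle := atomEnergy_le H 𝒜
    rw [Fintype.card_fin] at hle
    have hn0 : (0 : ℝ) < (n : ℝ) ^ 3 := by
      have : (0 : ℝ) < n := by exact_mod_cast (Nat.zero_le _).trans_lt hn
      positivity
    rw [div_lt_iff₀ hγ0] at hJ
    nlinarith

/-- Weak regularity lemma for 3-graphs, in a form where moreover every cluster is in few irregular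
triples. -/
theorem exists_regular_blocks_of_all {ε β : ℝ} (hε : 0 < ε) (hβ : 0 < β)
    (hβ' : β ≤ 1 / 2) (t₀ : ℕ) :
    ∃ T n₀ : ℕ, ∀ n : ℕ, n > n₀ → ∀ H : Finset (Finset (Fin n)),
      ∃ (t m : ℕ) (P : Fin t → Finset (Fin n)), t₀ < t ∧ t < T ∧ 0 < m ∧ (∀ i, #(P i) = m) ∧
        (∀ i j, i ≠ j → Disjoint (P i) (P j)) ∧ (1 - 2 * β) * n ≤ t * m ∧
        #(irregularTriples ε H P) ≤ 8 * β ^ 2 * (t : ℝ) ^ 3 ∧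
        ∀ i, #{q ∈ irregularTriples ε H P | q.1 = i} ≤ 4 * β * (t : ℝ) ^ 2 := by
  obtain ⟨T, n₀, h⟩ := exists_regular_blocks hε (pow_pos hβ 2) hβ hβ' (2 * t₀)
  refine ⟨T, n₀, fun n hn H => ?_⟩
  obtain ⟨s, m, P, hs, hsT, hm, hPm, hP, hcov, hirr⟩ := h n hn H
  have hs0 : (0 : ℝ) < s := by exact_mod_cast (Nat.zero_le _).trans_lt hs
  set G : Finset (Fin s) := {i | #{q ∈ irregularTriples ε H P | q.1 = i} ≤ β * (s : ℝ) ^ 2} with hG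
  have hGc : (#Gᶜ : ℝ) ≤ β * s := by
    have h1 : (#Gᶜ : ℝ) * (β * (s : ℝ) ^ 2) ≤ #(irregularTriples ε H P) := by
      rw [card_eq_sum_card_fiberwise (f := Prod.fst) (t := univ) (by simp), Nat.cast_sum]
      calc (#Gᶜ : ℝ) * (β * (s : ℝ) ^ 2) = ∑ i ∈ Gᶜ, β * (s : ℝ) ^ 2 := by simp
        _ ≤ ∑ i ∈ Gᶜ, (#{q ∈ irregularTriples ε H P | q.1 = i} : ℝ) := by
          refine sum_le_sum fun i hi => ?_
          simp only [hG, compl_filter, mem_filter, not_le] at hi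
          exact hi.2.le
        _ ≤ _ := sum_le_sum_of_subset_of_nonneg (subset_univ _) fun _ _ _ => by positivity
    have h2 : (#Gᶜ : ℝ) * (β * (s : ℝ) ^ 2) ≤ (β * s) * (β * (s : ℝ) ^ 2) := by
      refine (h1.trans hirr).trans_eq (by ring)
    exact le_of_mul_le_mul_right h2 (by positivity)
  have hGcard : (#G : ℝ) + #Gᶜ = s := by
    have := card_add_card_compl G
    rw [Fintype.card_fin] at this
    exact_mod_cast this
  have hGge : (1 - β) * s ≤ #G := by linarith
  have hGhalf : (s : ℝ) ≤ 2 * #G := by nlinarith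
  set e := G.orderEmbOfFin rfl with he
  have heG : ∀ i, e i ∈ G := fun i => G.orderEmbOfFin_mem rfl i
  have einj : Function.Injective fun q : Fin #G × Fin #G × Fin #G => (e q.1, e q.2.1, e q.2.2) := by
    rintro ⟨a, b, c⟩ ⟨a', b', c'⟩ h
    simpa using h
  have hmem : ∀ q, q ∈ irregularTriples ε H (P ∘ e) →
      (e q.1, e q.2.1, e q.2.2) ∈ irregularTriples ε H P := by
    intro q hq
    simpa [irregularTriples] using hq
  refine ⟨#G, m, P ∘ e, ?_, ?_, hm, fun i => hPm _, fun i j hij => hP _ _ (by simpa using hij),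
    ?_, ?_, fun i => ?_⟩
  · have : s ≤ 2 * #G := by exact_mod_cast hGhalf
    omega
  · have : #G ≤ s := by simpa using card_le_univ G
    omega
  · have h1 : (1 - 2 * β) * n ≤ (1 - β) * ((1 - β) * n) := by
      nlinarith [mul_nonneg (sq_nonneg β) (Nat.cast_nonneg (α := ℝ) n)]
    calc (1 - 2 * β) * n ≤ (1 - β) * ((1 - β) * n) := h1
      _ ≤ (1 - β) * (s * m) := by
        have : 0 ≤ 1 - β := by linarith
        gcongr
      _ = (1 - β) * s * m := by ring
      _ ≤ _ := by gcongr
  · have h1 : (#(irregularTriples ε H (P ∘ e)) : ℝ) ≤ #(irregularTriples ε H P) := by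
      exact_mod_cast card_le_card_of_injOn _ hmem einj.injOn
    calc _ ≤ β ^ 2 * (s : ℝ) ^ 3 := h1.trans hirr
      _ ≤ β ^ 2 * (2 * #G : ℝ) ^ 3 := by gcongr
      _ = _ := by ring
  · have h1 : (#{q ∈ irregularTriples ε H (P ∘ e) | q.1 = i} : ℝ) ≤
        #{q ∈ irregularTriples ε H P | q.1 = e i} := by
      refine Nat.cast_le.2 (card_le_card_of_injOn _ (fun q hq => ?_) einj.injOn)
      have hq := mem_filter.1 hq
      exact mem_filter.2 ⟨hmem q hq.1, by simp [hq.2]⟩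
    have h2 := (mem_filter.1 (heG i)).2
    calc _ ≤ β * (s : ℝ) ^ 2 := h1.trans h2
      _ ≤ β * (2 * #G : ℝ) ^ 2 := by gcongr
      _ = _ := by ring

section Degree

variable {V : Type*} [DecidableEq V]

theorem two_mul_hdeg_le [Fintype V] (H : Finset (Finset V)) (hH : ∀ e ∈ H, #e = 3) (x : V) :
    2 * (hdeg H x : ℝ) ≤ ∑ y, ∑ z, edgeInd H (x, y, z) := by
  simp only [edgeInd]
  rw [← sum_product', sum_boole]
  have : #{e ∈ H | x ∈ e} * 2 ≤ #{p ∈ (univ : Finset V) ×ˢ univ | {x, p.1, p.2} ∈ H} := by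
    rw [card_eq_sum_card_fiberwise (f := fun p : V × V => ({x, p.1, p.2} : Finset V))
      (t := {e ∈ H | x ∈ e}) (fun p hp => by simpa using hp), ← smul_eq_mul]
    refine card_nsmul_le_sum _ _ _ fun e he => ?_
    obtain ⟨he, hxe⟩ := mem_filter.1 he
    obtain ⟨y, z, hyz, hez⟩ := card_eq_two.1
      (show #(e.erase x) = 2 by rw [card_erase_of_mem hxe, hH e he])
    have hxyz : e = {x, y, z} := by rw [← insert_erase hxe, hez]
    have hsub : ({(y, z), (z, y)} : Finset (V × V)) ⊆
        (((univ : Finset V) ×ˢ univ).filter fun p => {x, p.1, p.2} ∈ H).filter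
          fun p => ({x, p.1, p.2} : Finset V) = e := by
      have h1 : ({x, z, y} : Finset V) = {x, y, z} := by rw [pair_comm]
      subst hxyz
      intro p hp
      simp only [mem_insert, mem_singleton] at hp
      rcases hp with rfl | rfl <;> simp [he, h1]
    refine le_trans (le_of_eq ?_) (card_le_card hsub)
    rw [card_pair]
    simp [hyz]
  have h2 : 2 * hdeg H x ≤ #{p ∈ (univ : Finset V) ×ˢ univ | {x, p.1, p.2} ∈ H} := by
    rw [hdeg]; omega
  exact_mod_cast h2

theorem card_le_two_mul_hdeg (K : Finset (Finset V)) (x : V) (S : Finset (V × V))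
    (hS : ∀ p ∈ S, x ≠ p.1 ∧ x ≠ p.2 ∧ p.1 ≠ p.2 ∧ {x, p.1, p.2} ∈ K) : #S ≤ 2 * hdeg K x := by
  refine card_le_mul_card_image_of_maps_to (f := fun p => {x, p.1, p.2})
    (fun p hp => mem_filter.2 ⟨(hS p hp).2.2.2, by simp⟩) 2 fun e _ => ?_
  rcases (S.filter fun p => ({x, p.1, p.2} : Finset V) = e).eq_empty_or_nonempty with
    h | ⟨⟨y, z⟩, h⟩
  · simp [h]
  · refine (card_le_card (t := ({(y, z), (z, y)} : Finset (V × V))) ?_).trans card_le_two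
    obtain ⟨hyz, rfl⟩ := mem_filter.1 h
    rintro ⟨y', z'⟩ h'
    obtain ⟨hyz', heq⟩ := mem_filter.1 h'
    obtain ⟨a1, a2, a3, -⟩ := hS _ hyz
    obtain ⟨b1, b2, b3, -⟩ := hS _ hyz'
    simp only at heq a1 a2 a3 b1 b2 b3
    have h1 : y' ∈ ({x, y, z} : Finset V) := heq ▸ by simp
    have h2 : z' ∈ ({x, y, z} : Finset V) := heq ▸ by simp
    simp only [mem_insert, mem_singleton] at h1 h2
    simp only [mem_insert, mem_singleton, Prod.mk.injEq]
    grind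

theorem sum_sum_le_sum_blocks [Fintype V] {t m : ℕ} {P : Fin t → Finset V}
    (hPm : ∀ i, #(P i) = m) (hP : ∀ i j, i ≠ j → Disjoint (P i) (P j)) (f : V → V → ℝ) {b : ℝ}
    (hf : ∀ y z, 0 ≤ f y z) (hfb : ∀ y z, f y z ≤ b) :
    ∑ y, ∑ z, f y z ≤ ∑ j, ∑ k, ∑ y ∈ P j, ∑ z ∈ P k, f y z +
      2 * (Fintype.card V - t * m) * Fintype.card V * b := by
  set U := univ.biUnion P with hU
  have hUc : (#Uᶜ : ℝ) = Fintype.card V - t * m := by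
    have h1 := card_add_card_compl U
    rw [hU, card_biUnion_blocks hPm hP, ← hU] at h1
    rw [← h1]; push_cast; ring
  have hblocks : ∑ j, ∑ k, ∑ y ∈ P j, ∑ z ∈ P k, f y z = ∑ y ∈ U, ∑ z ∈ U, f y z := by
    rw [hU, sum_biUnion fun i _ j _ h => hP i j h]
    refine sum_congr rfl fun j _ => ?_
    rw [sum_comm]
    refine sum_congr rfl fun y _ => ?_
    rw [sum_biUnion fun i _ j _ h => hP i j h]
  have hrow : ∀ y, ∑ z, f y z ≤ ∑ z ∈ U, f y z + #Uᶜ * b := by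
    intro y
    rw [← sum_add_sum_compl U]
    gcongr
    rw [← nsmul_eq_mul]
    exact sum_le_card_nsmul _ _ _ fun z _ => hfb y z
  have hrow' : ∀ y, ∑ z ∈ U, f y z ≤ Fintype.card V * b := by
    intro y
    calc ∑ z ∈ U, f y z ≤ ∑ z, f y z :=
          sum_le_sum_of_subset_of_nonneg (subset_univ _) fun _ _ _ => hf _ _
      _ ≤ #(univ : Finset V) • b := sum_le_card_nsmul _ _ _ fun z _ => hfb y z
      _ = _ := by simp
  calc ∑ y, ∑ z, f y z ≤ ∑ y, (∑ z ∈ U, f y z + #Uᶜ * b) := sum_le_sum fun y _ => hrow y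
    _ = ∑ y ∈ U, ∑ z ∈ U, f y z + ∑ y ∈ Uᶜ, ∑ z ∈ U, f y z + Fintype.card V * (#Uᶜ * b) := by
      rw [sum_add_distrib, sum_add_sum_compl]; simp
    _ ≤ ∑ y ∈ U, ∑ z ∈ U, f y z + #Uᶜ * (Fintype.card V * b) + Fintype.card V * (#Uᶜ * b) := by
      gcongr
      rw [← nsmul_eq_mul]
      exact sum_le_card_nsmul _ _ _ fun y _ => hrow' y
    _ = _ := by rw [hblocks, hUc]; ring

theorem cluster_degree_inequality [Fintype V] {t m : ℕ} {ε d c : ℝ} (hd : 0 ≤ d)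
    (H : Finset (Finset V)) (hH : ∀ e ∈ H, #e = 3) {P : Fin t → Finset V}
    (hPm : ∀ i, #(P i) = m) (hP : ∀ i j, i ≠ j → Disjoint (P i) (P j))
    (hdeg : ∀ x, c ≤ hdeg H x) (i : Fin t) (S : Finset (Fin t × Fin t))
    (hS : ∀ j k, i ≠ j → i ≠ k → j ≠ k → EpsDRegular ε d H (P i) (P j) (P k) → (j, k) ∈ S) :
    2 * c * m ≤ (#S + #{q ∈ irregularTriples ε H P | q.1 = i} + 3 * t + d * t ^ 2) * m ^ 3 +
      2 * (Fintype.card V - t * m) * Fintype.card V * m := by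
  classical
  have hcast : ∀ i, (#(P i) : ℝ) = m := fun i => by rw [hPm]
  have hsum : 2 * c * m ≤ ∑ y, ∑ z, ∑ x ∈ P i, edgeInd H (x, y, z) := by
    calc 2 * c * m = ∑ x ∈ P i, 2 * c := by rw [sum_const, nsmul_eq_mul, hcast]; ring
      _ ≤ ∑ x ∈ P i, ∑ y, ∑ z, edgeInd H (x, y, z) := by
        refine sum_le_sum fun x _ => le_trans ?_ (two_mul_hdeg_le H hH x)
        linarith [hdeg x]
      _ = _ := by
        rw [sum_comm]
        exact sum_congr rfl fun y _ => sum_comm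
  refine hsum.trans ((sum_sum_le_sum_blocks hPm hP (fun y z => ∑ x ∈ P i, edgeInd H (x, y, z))
    (b := m) (fun y z => sum_nonneg fun _ _ => edgeInd_nonneg _ _) fun y z => ?_).trans ?_)
  · calc _ ≤ #(P i) • (1 : ℝ) := sum_le_card_nsmul _ _ _ fun x _ => edgeInd_le_one _ _
      _ = m := by simp [hPm]
  gcongr
  have hblock : ∀ j k, ∑ y ∈ P j, ∑ z ∈ P k, ∑ x ∈ P i, edgeInd H (x, y, z) =
      ∑ p ∈ P i ×ˢ P j ×ˢ P k, edgeInd H p := by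
    intro j k
    rw [sum_product, ← sum_product' (f := fun y z => ∑ x ∈ P i, edgeInd H (x, y, z)), sum_comm]
  have hcell : ∀ j k, (#(P i ×ˢ P j ×ˢ P k) : ℝ) = m ^ 3 := by
    intro j k
    simp only [card_product, Nat.cast_mul, hcast]; ring
  have hone : ∀ j k, ∑ p ∈ P i ×ˢ P j ×ˢ P k, edgeInd H p ≤ (m : ℝ) ^ 3 := by
    intro j k
    rw [← hcell j k]
    simpa using sum_le_card_nsmul (P i ×ˢ P j ×ˢ P k) _ 1 fun p _ => edgeInd_le_one H p
  have hm3 : (0 : ℝ) ≤ (m : ℝ) ^ 3 := by positivity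
  have key : ∀ j k, ∑ y ∈ P j, ∑ z ∈ P k, ∑ x ∈ P i, edgeInd H (x, y, z) ≤
      ((if (j, k) ∈ S then 1 else 0) + (if (i, j, k) ∈ irregularTriples ε H P then 1 else 0) +
        ((if i = j then 1 else 0) + (if i = k then 1 else 0) + (if j = k then 1 else 0)) + d) *
        (m : ℝ) ^ 3 := by
    intro j k
    rw [hblock]
    have hone := hone j k
    have h01 : ∀ (p : Prop) [Decidable p], (0 : ℝ) ≤ if p then 1 else 0 := by
      intro p _; split_ifs <;> norm_num
    have p1 := h01 ((j, k) ∈ S)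
    have p2 := h01 ((i, j, k) ∈ irregularTriples ε H P)
    have p3 := h01 (i = j)
    have p4 := h01 (i = k)
    have p5 := h01 (j = k)
    by_cases hbig : i = j ∨ i = k ∨ j = k ∨ (i, j, k) ∈ irregularTriples ε H P ∨ (j, k) ∈ S
    · refine hone.trans (le_mul_of_one_le_left hm3 ?_)
      rcases hbig with h | h | h | h | h <;> rw [if_pos h] at * <;> linarith
    · push Not at hbig
      obtain ⟨hij, hik, hjk, hirr, hjS⟩ := hbig
      have hreg : EpsRegular ε H (P i) (P j) (P k) := by
        by_contra hcon
        exact hirr (by simp [irregularTriples, hij, hik, hjk, hcon])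
      have hden : dens H (P i) (P j) (P k) < d := by
        by_contra hcon
        exact hjS (hS j k hij hik hjk ⟨hreg, not_lt.1 hcon⟩)
      rw [← dens_mul_card H (hP _ _ hij) (hP _ _ hik) (hP _ _ hjk), hcell]
      gcongr
      linarith
  refine (sum_le_sum fun j _ => sum_le_sum fun k _ => key j k).trans (le_of_eq ?_)
  simp_rw [← sum_mul, sum_add_distrib]
  congr 1
  have c1 : ∑ j, ∑ k, (if (j, k) ∈ S then (1 : ℝ) else 0) = #S := by
    rw [← sum_product' (f := fun j k => if (j, k) ∈ S then (1 : ℝ) else 0)]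
    simp
  have c2 : ∑ j, ∑ k, (if (i, j, k) ∈ irregularTriples ε H P then (1 : ℝ) else 0) =
      #{q ∈ irregularTriples ε H P | q.1 = i} := by
    rw [← sum_product' (f := fun j k => if (i, j, k) ∈ irregularTriples ε H P then (1 : ℝ) else 0),
      sum_boole]
    congr 1
    refine card_bij (fun p _ => (i, p)) ?_ ?_ ?_
    · rintro ⟨j, k⟩ h
      simpa using h
    · rintro p - q - h
      simpa using h
    · rintro ⟨i', p⟩ h
      obtain ⟨h, rfl⟩ := mem_filter.1 h
      exact ⟨p, by simpa using h, rfl⟩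
  rw [c1, c2]
  simp
  ring

end Degree

theorem cube_le_mul_choose_three {t : ℕ} (ht : 4 ≤ t) : (t : ℝ) ^ 3 ≤ 16 * (t.choose 3 : ℝ) := by
  have h4 : (4 : ℝ) ≤ t := by exact_mod_cast ht
  have h : (t.choose 3 : ℝ) = t * (t - 1) * (t - 2) / 6 := by
    rw [Nat.cast_choose_eq_descPochhammer_div]
    simp [descPochhammer_succ_right, Nat.factorial]
  rw [h]
  nlinarith [mul_nonneg (sub_nonneg.2 h4) (sub_nonneg.2 h4),
    mul_nonneg (mul_nonneg (sub_nonneg.2 h4) (sub_nonneg.2 h4)) (sub_nonneg.2 h4)]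

theorem degree_arithmetic {c d ε β n m t D I : ℝ} (hcd : 0 ≤ c - ε - d) (hβ : 16 * β ≤ ε)
    (hn : 4 * c ≤ ε * n) (hn0 : 0 ≤ n) (hm : 0 < m) (ht : 12 ≤ ε * t) (ht0 : 0 ≤ t)
    (htm : t * m ≤ n) (hcov : (1 - 2 * β) * n ≤ t * m) (hI : I ≤ 4 * β * t ^ 2)
    (h : 2 * (c * (n * (n - 1) / 2)) * m ≤
      (D + I + 3 * t + d * t ^ 2) * m ^ 3 + 2 * (n - t * m) * n * m)
    (hd : 0 ≤ d) : (c - ε - d) * t ^ 2 ≤ D := by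
  have h1 : c * (n * (n - 1)) ≤ (D + I + 3 * t + d * t ^ 2) * m ^ 2 + 2 * (n - t * m) * n := by
    refine le_of_mul_le_mul_right ?_ hm
    linarith
  have hε : 0 ≤ ε := by
    by_contra hcon
    nlinarith
  have htm2 : t ^ 2 * m ^ 2 ≤ n ^ 2 := by
    rw [← mul_pow]; gcongr
  have hIm : I * m ^ 2 ≤ ε / 4 * n ^ 2 := by
    calc I * m ^ 2 ≤ 4 * β * t ^ 2 * m ^ 2 := by gcongr
      _ ≤ ε / 4 * t ^ 2 * m ^ 2 := by gcongr; linarith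
      _ = ε / 4 * (t ^ 2 * m ^ 2) := by ring
      _ ≤ _ := by gcongr
  have h3t : 3 * t * m ^ 2 ≤ ε / 4 * n ^ 2 := by
    calc 3 * t * m ^ 2 = 12 / 4 * (t * m ^ 2) := by ring
      _ ≤ (ε * t) / 4 * (t * m ^ 2) := by gcongr
      _ = ε / 4 * (t ^ 2 * m ^ 2) := by ring
      _ ≤ _ := by gcongr
  have hdt : d * t ^ 2 * m ^ 2 ≤ d * n ^ 2 := by
    rw [mul_assoc]; gcongr
  have hunc : 2 * (n - t * m) * n ≤ ε / 4 * n ^ 2 := by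
    have : n - t * m ≤ ε / 8 * n := by nlinarith
    nlinarith
  have hcn : c * n ≤ ε / 4 * n ^ 2 := by nlinarith
  have hfin : (c - ε - d) * n ^ 2 ≤ D * m ^ 2 := by nlinarith
  have hm2 : 0 < m ^ 2 := by positivity
  refine le_of_mul_le_mul_right ?_ hm2
  calc (c - ε - d) * t ^ 2 * m ^ 2 = (c - ε - d) * (t ^ 2 * m ^ 2) := by ring
    _ ≤ (c - ε - d) * n ^ 2 := by gcongr
    _ ≤ _ := hfin

end RegularityLemma

/-- Regularity: a 3-graph with minimum vertex degree `c C(n,2)` admits an `(ε,t)`-regular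
partition whose cluster hypergraph `K(ε,d,Q)` has minimum vertex degree
`(c - ε - d) C(t,2)`. -/
theorem stmt_8 (c d ε : ℝ) (hε : 0 < ε) (hεd : ε < d) (hdc : d < c) (t₀ : ℕ) :
    ∃ T₀ n₀ : ℕ, ∀ n : ℕ, n > n₀ →
      ∀ H : Finset (Finset (Fin n)), (∀ e ∈ H, e.card = 3) →
      (∀ x : Fin n, c * (n.choose 2 : ℝ) ≤ (hdeg H x : ℝ)) →
      ∃ t : ℕ, t₀ < t ∧ t < T₀ ∧
      ∃ (V₀ : Finset (Fin n)) (P : Fin t → Finset (Fin n)),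
        -- (V₀, P 0, …, P (t-1)) is a partition of the vertex set
        (∀ i, Disjoint V₀ (P i)) ∧
        (∀ i j, i ≠ j → Disjoint (P i) (P j)) ∧
        (V₀ ∪ Finset.univ.biUnion P = Finset.univ) ∧
        -- the clusters have equal sizes and V₀ is small
        (∀ i j, (P i).card = (P j).card) ∧
        ((V₀.card : ℝ) ≤ ε * n) ∧
        -- all but at most ε C(t,3) triples of clusters are ε-regular
        (∃ Bad : Finset (Finset (Fin t)),
          ((Bad.card : ℝ) ≤ ε * (t.choose 3 : ℝ)) ∧
          ∀ i j k : Fin t, i ≠ j → i ≠ k → j ≠ k →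
            ({i, j, k} : Finset (Fin t)) ∉ Bad →
            EpsRegular ε H (P i) (P j) (P k)) ∧
        -- the cluster hypergraph has large minimum vertex degree
        (∃ K : Finset (Finset (Fin t)),
          (∀ e : Finset (Fin t), e ∈ K ↔
            ∃ i j k : Fin t, i ≠ j ∧ i ≠ k ∧ j ≠ k ∧ e = {i, j, k} ∧
              EpsDRegular ε d H (P i) (P j) (P k)) ∧
          ∀ i : Fin t, (c - ε - d) * (t.choose 2 : ℝ) ≤ (hdeg K i : ℝ)) := by
  classical
  set β : ℝ := min ε 1 / 128 with hβ
  have hmin : 0 < min ε 1 := lt_min hε one_pos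
  have hβ0 : 0 < β := by positivity
  have hβε : 128 * β ≤ ε := by
    have := min_le_left ε 1
    linarith
  have hβ1 : 128 * β ≤ 1 := by
    have := min_le_right ε 1
    linarith
  obtain ⟨T, n₀, h⟩ := exists_regular_blocks_of_all hε hβ0 (by linarith) (t₀ + 4 + ⌈12 / ε⌉₊)
  refine ⟨T, n₀ + ⌈4 * c / ε⌉₊, fun n hn H hH hdegH => ?_⟩
  obtain ⟨t, m, P, ht, htT, hm, hPm, hP, hcov, hirr, hirr'⟩ := h n (by omega) H
  have ht12 : 12 ≤ ε * t := by
    have h1 : 12 / ε ≤ t := (Nat.le_ceil _).trans (by exact_mod_cast (by omega))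
    rw [div_le_iff₀ hε] at h1
    linarith
  have hn4 : 4 * c ≤ ε * n := by
    have h1 : 4 * c / ε ≤ n := (Nat.le_ceil _).trans (by exact_mod_cast (by omega))
    rw [div_le_iff₀ hε] at h1
    linarith
  have hcard := card_blocks_le hPm hP
  rw [Fintype.card_fin] at hcard
  have htm : (t : ℝ) * m ≤ n := by exact_mod_cast hcard
  refine ⟨t, by omega, htT, (Finset.univ.biUnion P)ᶜ, P, fun i => ?_, hP, ?_,
    fun i j => by rw [hPm, hPm], ?_, ?_, ?_⟩
  · exact (disjoint_compl_left).mono_right (Finset.subset_biUnion_of_mem P (Finset.mem_univ i))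
  · rw [Finset.union_comm]
    exact Finset.union_compl _
  · rw [Finset.card_compl, card_biUnion_blocks hPm hP, Fintype.card_fin, Nat.cast_sub hcard]
    push_cast
    nlinarith [Nat.cast_nonneg (α := ℝ) n]
  · refine ⟨(irregularTriples ε H P).image fun q => {q.1, q.2.1, q.2.2}, ?_, ?_⟩
    · have h1 : (((irregularTriples ε H P).image fun q => ({q.1, q.2.1, q.2.2} :
          Finset (Fin t))).card : ℝ) ≤ (irregularTriples ε H P).card := by
        exact_mod_cast Finset.card_image_le
      have h2 := cube_le_mul_choose_three (t := t) (by omega)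
      have h3 : 8 * β ^ 2 * 16 ≤ ε := by nlinarith
      calc _ ≤ 8 * β ^ 2 * (t : ℝ) ^ 3 := h1.trans hirr
        _ ≤ 8 * β ^ 2 * (16 * (t.choose 3 : ℝ)) := by gcongr
        _ = 8 * β ^ 2 * 16 * (t.choose 3 : ℝ) := by ring
        _ ≤ _ := by gcongr
    · intro i j k hij hik hjk hmem
      by_contra hcon
      exact hmem (Finset.mem_image.2 ⟨(i, j, k), by simp [irregularTriples, *], rfl⟩)
  · refine ⟨Finset.univ.filter fun e => ∃ i j k : Fin t, i ≠ j ∧ i ≠ k ∧ j ≠ k ∧ e = {i, j, k} ∧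
      EpsDRegular ε d H (P i) (P j) (P k), fun e => by simp, fun i => ?_⟩
    set K : Finset (Finset (Fin t)) := Finset.univ.filter fun e => ∃ i j k : Fin t,
      i ≠ j ∧ i ≠ k ∧ j ≠ k ∧ e = {i, j, k} ∧ EpsDRegular ε d H (P i) (P j) (P k) with hK
    rcases le_or_gt (c - ε - d) 0 with hneg | hpos
    · exact (mul_nonpos_of_nonpos_of_nonneg hneg (by positivity)).trans (by positivity)
    set S : Finset (Fin t × Fin t) := Finset.univ.filter fun p => i ≠ p.1 ∧ i ≠ p.2 ∧
      p.1 ≠ p.2 ∧ EpsDRegular ε d H (P i) (P p.1) (P p.2) with hS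
    have hSK : S.card ≤ 2 * hdeg K i := by
      refine card_le_two_mul_hdeg K i S fun p hp => ?_
      obtain ⟨-, h1, h2, h3, h4⟩ := Finset.mem_filter.1 hp
      exact ⟨h1, h2, h3, Finset.mem_filter.2 ⟨Finset.mem_univ _, i, p.1, p.2, h1, h2, h3, rfl, h4⟩⟩
    have hSK' : (S.card : ℝ) ≤ 2 * hdeg K i := by exact_mod_cast hSK
    have hineq := cluster_degree_inequality (by linarith) H hH hPm hP hdegH i S
      fun j k h1 h2 h3 h4 => Finset.mem_filter.2 ⟨Finset.mem_univ _, h1, h2, h3, h4⟩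
    rw [Nat.cast_choose_two, Fintype.card_fin] at hineq
    have hmain := degree_arithmetic hpos.le (by linarith) hn4 (by positivity)
      (by exact_mod_cast hm) ht12 (by positivity) htm hcov (hirr' i) hineq (by linarith)
    rw [Nat.cast_choose_two]
    nlinarith [mul_nonneg hpos.le (Nat.cast_nonneg (α := ℝ) t)]
end

section
/- For any reals γ₃, α with 0 < γ₃ < 1 and 0 < α < 1 there exist integers p and n₀ such that the following holds for all n > n₀. Suppose H is a 3-graph on n vertices with δ₁(H) ≥ (7/16 − γ₃)·C(n,2). Then either there are at most p pairwise vertex-disjoint loose paths in H that together cover all but at most α·n vertices of H, or H is 2050γ₃-extremal. -/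
/-- The number of edges of `H` contained in the vertex set `B`. -/
def eIn {α : Type*} [DecidableEq α] (H : Finset (Finset α)) (B : Finset α) : ℕ :=
  (H.filter (fun e => e ⊆ B)).card

/-- A 3-graph on `n` vertices is `β`-extremal if some vertex set `B` of size `⌊3n/4⌋`
spans at most `β n³` edges. -/
def BetaExtremal (β : ℝ) (n : ℕ) (H : Finset (Finset (Fin n))) : Prop :=
  ∃ B : Finset (Fin n), B.card = 3 * n / 4 ∧ (eIn H B : ℝ) ≤ β * (n : ℝ) ^ 3

/-- `v 0, v 1, …, v (2k)` is a loose path in the 3-graph `H`. -/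
def IsLoosePath {α : Type*} [DecidableEq α] (H : Finset (Finset α)) (k : ℕ)
    (v : ℕ → α) : Prop :=
  Set.InjOn v (Set.Iio (2 * k + 1)) ∧
  ∀ i : ℕ, i < k → ({v (2 * i), v (2 * i + 1), v (2 * i + 2)} : Finset α) ∈ H

/-- The vertex set of the loose path `v 0, …, v (2k)`. -/
def pathVerts {α : Type*} [DecidableEq α] (k : ℕ) (v : ℕ → α) : Finset α :=
  (Finset.range (2 * k + 1)).image v

theorem stability_numeric {a P Q x b ε : ℝ} (ha : 0 ≤ a) (hP : 0 ≤ P) (hQ : 0 ≤ Q)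
    (hPQ : P + Q ≤ 1 / 4 - a / 2) (hx : x ≤ a * (1 - a))
    (hx' : x ≤ 2 * ((1 - a) * P + a * Q)) (hN : 7 / 16 - ε ≤ a ^ 2 + 2 * x)
    (hb : b ≤ 4 * Q) (hε : 0 ≤ ε) : a + b ≤ 1 / 4 + 8 * ε := by
  have h1 : a ≤ 1 / 2 := by linarith
  have h2 : x ≤ 2 * (1 - a) * (1 / 4 - a / 2) - 2 * (1 - 2 * a) * Q := by
    nlinarith [mul_nonneg (by linarith : (0 : ℝ) ≤ 1 - a)
      (by linarith : (0 : ℝ) ≤ 1 / 4 - a / 2 - Q - P)]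
  have h3 : 1 / 4 - 2 * ε / 3 ≤ a := by nlinarith
  have h4 : 4 * (1 - 2 * a) * Q ≤ 3 * (a - 1 / 4) * (a - 3 / 4) + ε := by nlinarith
  have h5 : a ≤ 1 / 4 + 4 * ε / 3 := by
    by_contra! h
    nlinarith [mul_nonneg (by linarith : (0 : ℝ) ≤ 1 - 2 * a) hQ]
  by_contra! h
  have h6 : (1 - 2 * a) * (1 / 4 + 8 * ε - a) < 4 * (1 - 2 * a) * Q := by
    nlinarith
  rcases le_total (1 / 4) a with h7 | h7
  · nlinarith
  · nlinarith

/-- Stability for the Erdős–Gallai bound: if a nonnegative weight has mean at most `t / 4` and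
nearly a `7/16` proportion of the pairs have total weight exceeding `t`, then at most roughly a
quarter of the points have weight at least `t / 4`. -/
theorem card_heavy_le {V : Type*} [Fintype V] (v : V → ℝ) (hv : ∀ x, 0 ≤ v x) {t ε : ℝ}
    (ht : 0 < t) (hε : 0 ≤ ε)
    (hsum : ∑ x, v x ≤ Fintype.card V * t / 4)
    (hN : (7 / 16 - ε) * (Fintype.card V : ℝ) ^ 2 ≤
      ((Finset.univ.filter fun p : V × V => t < v p.1 + v p.2).card : ℝ)) :
    ((Finset.univ.filter fun x => t / 4 ≤ v x).card : ℝ) ≤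
      (1 / 4 + 8 * ε) * Fintype.card V := by
  classical
  set n : ℝ := (Fintype.card V : ℝ) with hn
  have hn0 : 0 ≤ n := Nat.cast_nonneg _
  rcases hn0.eq_or_lt with h0 | hpos
  · have h1 : ((Finset.univ.filter fun x => t / 4 ≤ v x).card : ℝ) ≤ n := by
      rw [hn]; exact_mod_cast Finset.card_le_univ _
    rw [← h0] at h1 ⊢
    linarith
  set A := Finset.univ.filter fun x => t / 2 ≤ v x with hA
  set C := Finset.univ.filter fun x => ¬ t / 2 ≤ v x with hC
  set X := (A ×ˢ C).filter fun p => t < v p.1 + v p.2 with hX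
  set S := C.filter fun x => t / 4 ≤ v x with hS
  set P := ∑ x ∈ A, (v x - t / 2) with hP
  set Q := ∑ x ∈ C, v x with hQ
  have hAC : (A.card : ℝ) + C.card = n := by
    rw [hn, hA, hC]
    exact_mod_cast Finset.card_filter_add_card_filter_not (s := (Finset.univ : Finset V)) _
  have hP0 : 0 ≤ P := Finset.sum_nonneg fun x hx => by
    simp only [hA, Finset.mem_filter] at hx; linarith [hx.2]
  have hQ0 : 0 ≤ Q := Finset.sum_nonneg fun x _ => hv x
  have hPQ : P + Q = ∑ x, v x - A.card * (t / 2) := by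
    rw [hP, hQ, Finset.sum_sub_distrib, Finset.sum_const, nsmul_eq_mul,
      ← Finset.sum_filter_add_sum_filter_not Finset.univ (fun x => t / 2 ≤ v x) v]
    ring
  have hXle : (X.card : ℝ) ≤ A.card * C.card := by
    have := Finset.card_filter_le (A ×ˢ C) fun p => t < v p.1 + v p.2
    rw [Finset.card_product] at this
    exact_mod_cast this
  have hXw : X.card * (t / 2) ≤ C.card * P + A.card * Q := by
    have h1 : ∑ p ∈ A ×ˢ C, ((v p.1 - t / 2) + v p.2) = C.card * P + A.card * Q := by
      rw [Finset.sum_product]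
      simp only [Finset.sum_add_distrib, Finset.sum_const, nsmul_eq_mul, ← hQ]
      rw [← Finset.mul_sum]
    rw [← h1, ← nsmul_eq_mul, ← Finset.sum_const]
    refine (Finset.sum_le_sum (f := fun _ => t / 2)
      (g := fun p : V × V => (v p.1 - t / 2) + v p.2) fun p hp => ?_).trans
      (Finset.sum_le_sum_of_subset_of_nonneg (Finset.filter_subset _ _) fun p hp _ => ?_)
    · have := (Finset.mem_filter.1 hp).2
      linarith
    · have := (Finset.mem_filter.1 (Finset.mem_product.1 hp).1).2
      linarith [hv p.2]
  have hSw : S.card * (t / 4) ≤ Q := by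
    rw [← nsmul_eq_mul, ← Finset.sum_const]
    exact (Finset.sum_le_sum fun x hx => (Finset.mem_filter.1 hx).2).trans
      (Finset.sum_le_sum_of_subset_of_nonneg (Finset.filter_subset _ _) fun x _ _ => hv x)
  have hNle : ((Finset.univ.filter fun p : V × V => t < v p.1 + v p.2).card : ℝ) ≤
      (A.card : ℝ) ^ 2 + 2 * X.card := by
    have hsub : (Finset.univ.filter fun p : V × V => t < v p.1 + v p.2) ⊆
        A ×ˢ A ∪ (X ∪ X.image Prod.swap) := by
      rintro ⟨y, z⟩ hp
      simp only [Finset.mem_filter, Finset.mem_univ, true_and] at hp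
      simp only [Finset.mem_union, Finset.mem_product, Finset.mem_image, hX, hA, hC,
        Finset.mem_filter, Finset.mem_univ, true_and, Prod.exists, Prod.swap_prod_mk,
        Prod.mk.injEq]
      by_cases h1 : t / 2 ≤ v y <;> by_cases h2 : t / 2 ≤ v z
      · exact Or.inl ⟨h1, h2⟩
      · exact Or.inr (Or.inl ⟨⟨h1, h2⟩, hp⟩)
      · exact Or.inr (Or.inr ⟨z, y, ⟨⟨h2, h1⟩, by linarith⟩, rfl, rfl⟩)
      · exfalso; linarith
    have h1 := (Finset.card_le_card hsub).trans (Finset.card_union_le _ _)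
    have h2 := Finset.card_union_le X (X.image Prod.swap)
    have h3 := Finset.card_image_le (s := X) (f := Prod.swap)
    rw [Finset.card_product] at h1
    have h4 : (Finset.univ.filter fun p : V × V => t < v p.1 + v p.2).card ≤
      A.card ^ 2 + 2 * X.card := by rw [sq]; omega
    exact_mod_cast h4
  have hcard : ((Finset.univ.filter fun x => t / 4 ≤ v x).card : ℝ) ≤ A.card + S.card := by
    have hsub : (Finset.univ.filter fun x => t / 4 ≤ v x) ⊆ A ∪ S := by
      intro x hx
      simp only [Finset.mem_filter, Finset.mem_univ, true_and] at hx
      simp only [Finset.mem_union, hA, hS, hC, Finset.mem_filter, Finset.mem_univ, true_and]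
      tauto
    exact_mod_cast (Finset.card_le_card hsub).trans (Finset.card_union_le _ _)
  have hCn : (C.card : ℝ) = n - A.card := by linarith
  have key := stability_numeric (a := A.card / n) (P := P / (n * t)) (Q := Q / (n * t))
    (x := X.card / n ^ 2) (b := S.card / n) (ε := ε) (by positivity) (by positivity)
    (by positivity) ?_ ?_ ?_ ?_ ?_ hε
  · rw [← add_div, div_le_iff₀ hpos] at key
    linarith
  · rw [← add_div, hPQ, div_le_iff₀ (by positivity)]
    have : (1 / 4 - A.card / n / 2) * (n * t) = n * t / 4 - A.card * (t / 2) := by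
      field_simp
    rw [this]; linarith
  · rw [div_le_iff₀ (by positivity)]
    have : A.card / n * (1 - A.card / n) * n ^ 2 = A.card * (n - A.card) := by field_simp
    rw [this, ← hCn]; exact hXle
  · rw [div_le_iff₀ (by positivity)]
    have : 2 * ((1 - A.card / n) * (P / (n * t)) + A.card / n * (Q / (n * t))) * n ^ 2
        = ((n - A.card) * P + A.card * Q) * (2 / t) := by field_simp
    rw [this, ← hCn]
    calc (X.card : ℝ) = X.card * (t / 2) * (2 / t) := by field_simp
      _ ≤ _ := by gcongr
  · have : (A.card / n) ^ 2 + 2 * (X.card / n ^ 2) = ((A.card : ℝ) ^ 2 + 2 * X.card) / n ^ 2 := by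
      field_simp
    rw [this, le_div_iff₀ (by positivity)]
    exact hN.trans hNle
  · rw [div_le_iff₀ hpos]
    have : 4 * (Q / (n * t)) * n = Q * (4 / t) := by field_simp
    rw [this]
    calc (S.card : ℝ) = S.card * (t / 4) * (4 / t) := by field_simp
      _ ≤ _ := by gcongr

/-- Any finite set contains a subset of prescribed size on which `u` is largest. -/
theorem exists_top_subset {V : Type*} [DecidableEq V] (S : Finset V) (u : V → ℝ) {k : ℕ}
    (hk : k ≤ S.card) :
    ∃ T ⊆ S, T.card = k ∧ ∀ x ∈ T, ∀ y ∈ S \ T, u y ≤ u x := by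
  induction k with
  | zero => exact ⟨∅, by simp, rfl, by simp⟩
  | succ k ih =>
    obtain ⟨T, hTS, hT, htop⟩ := ih (by omega)
    have hne : (S \ T).Nonempty := by
      rw [← Finset.card_pos, Finset.card_sdiff_of_subset hTS]; omega
    obtain ⟨x, hx, hmax⟩ := Finset.exists_max_image (S \ T) u hne
    rw [Finset.mem_sdiff] at hx
    refine ⟨insert x T, Finset.insert_subset hx.1 hTS, ?_, ?_⟩
    · rw [Finset.card_insert_of_notMem hx.2, hT]
    · intro y hy z hz
      rw [Finset.mem_sdiff, Finset.mem_insert, not_or] at hz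
      have hzS : z ∈ S \ T := Finset.mem_sdiff.2 ⟨hz.1, hz.2.2⟩
      rcases Finset.mem_insert.1 hy with rfl | hy
      · exact hmax z hzS
      · exact htop y hy z hzS

/-- The triples of `R` lying in `A × B × C`. -/
def boxCount {V : Type*} (R : V → V → V → Prop) [∀ x y z, Decidable (R x y z)]
    (A B C : Finset V) : ℕ :=
  ∑ x ∈ A, ∑ y ∈ B, ∑ z ∈ C, if R x y z then 1 else 0

/-- Every three subsets of `A`, `B`, `C` of size at least `s` span a triple of `R`. -/
def LowerRegular {V : Type*} (R : V → V → V → Prop) (s : ℕ) (A B C : Finset V) : Prop :=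
  ∀ A' ⊆ A, ∀ B' ⊆ B, ∀ C' ⊆ C, s ≤ A'.card → s ≤ B'.card → s ≤ C'.card →
    ∃ x ∈ A', ∃ y ∈ B', ∃ z ∈ C', R x y z

theorem LowerRegular.mono {V : Type*} {R R' : V → V → V → Prop} {s : ℕ}
    {A B C A' B' C' : Finset V} (h : LowerRegular R s A B C) (hR : ∀ x y z, R x y z → R' x y z)
    (hA : A' ⊆ A) (hB : B' ⊆ B) (hC : C' ⊆ C) : LowerRegular R' s A' B' C' := by
  intro A₁ hA₁ B₁ hB₁ C₁ hC₁ ha hb hc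
  obtain ⟨x, hx, y, hy, z, hz, hxyz⟩ :=
    h A₁ (hA₁.trans hA) B₁ (hB₁.trans hB) C₁ (hC₁.trans hC) ha hb hc
  exact ⟨x, hx, y, hy, z, hz, hR _ _ _ hxyz⟩

/-- A set of size `r * s` splits into `r` sets of size `s`, one of which may be prescribed. -/
theorem exists_split {V : Type*} [DecidableEq V] (r s : ℕ) (A A₀ : Finset V)
    (hA : A.card = (r + 1) * s) (hA₀ : A₀ ⊆ A) (hs : A₀.card = s) :
    ∃ P : ℕ → Finset V, P 0 = A₀ ∧ (∀ i < r + 1, P i ⊆ A ∧ (P i).card = s) ∧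
      ∀ f : V → ℕ, ∑ x ∈ A, f x = ∑ i ∈ Finset.range (r + 1), ∑ x ∈ P i, f x := by
  induction r generalizing A A₀ with
  | zero =>
    have : A₀ = A := Finset.eq_of_subset_of_card_le hA₀ (by rw [hA, hs]; omega)
    exact ⟨fun _ => A₀, rfl, fun _ _ => ⟨hA₀, hs⟩, fun f => by simp [this]⟩
  | succ r ih =>
    have hc : (A \ A₀).card = (r + 1) * s := by
      rw [Finset.card_sdiff_of_subset hA₀, hA, hs, Nat.add_mul (r + 1) 1 s]; omega
    obtain ⟨A₁, hA₁, hA₁s⟩ := Finset.exists_subset_card_eq (s := A \ A₀) (n := s)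
      (by rw [hc]; exact Nat.le_mul_of_pos_left _ (by omega))
    obtain ⟨P, -, hP, hsum⟩ := ih (A \ A₀) A₁ hc hA₁ hA₁s
    refine ⟨fun i => Nat.casesOn i A₀ P, rfl, ?_, ?_⟩
    · rintro (_ | i) hi
      · exact ⟨hA₀, hs⟩
      · exact ⟨(hP i (by omega)).1.trans Finset.sdiff_subset, (hP i (by omega)).2⟩
    · intro f
      rw [Finset.sum_range_succ', ← hsum f]
      exact (Finset.sum_sdiff hA₀).symm

theorem boxCount_le {V : Type*} (R : V → V → V → Prop) [∀ x y z, Decidable (R x y z)]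
    (A B C : Finset V) : boxCount R A B C ≤ A.card * B.card * C.card := by
  unfold boxCount
  calc _ ≤ ∑ x ∈ A, ∑ y ∈ B, ∑ z ∈ C, 1 := by
        gcongr; split_ifs <;> simp
    _ = _ := by simp [mul_assoc]

theorem exists_lowerRegular {V : Type*} [DecidableEq V] (R : V → V → V → Prop)
    [∀ x y z, Decidable (R x y z)] (r q J : ℕ) (A B C : Finset V)
    (hA : A.card = (r + 1) ^ J * q) (hB : B.card = (r + 1) ^ J * q)
    (hC : C.card = (r + 1) ^ J * q)
    (h : ((r + 1) ^ 3 - 1) ^ J * q ^ 3 < boxCount R A B C) :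
    ∃ s A' B' C', q ≤ s ∧ A' ⊆ A ∧ B' ⊆ B ∧ C' ⊆ C ∧ A'.card = (r + 1) * s ∧
      B'.card = (r + 1) * s ∧ C'.card = (r + 1) * s ∧ LowerRegular R s A' B' C' := by
  induction J generalizing A B C with
  | zero =>
    have := boxCount_le R A B C
    rw [hA, hB, hC] at this
    simp only [pow_zero, one_mul] at this h
    nlinarith
  | succ J ih =>
    by_cases hreg : LowerRegular R ((r + 1) ^ J * q) A B C
    · refine ⟨(r + 1) ^ J * q, A, B, C, Nat.le_mul_of_pos_left _ (by positivity), subset_rfl,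
        subset_rfl, subset_rfl, ?_, ?_, ?_, hreg⟩ <;> simp only [hA, hB, hC] <;> ring
    · unfold LowerRegular at hreg
      push Not at hreg
      obtain ⟨A₁, hA₁, B₁, hB₁, C₁, hC₁, ha, hb, hc, hhole⟩ := hreg
      obtain ⟨A₀, hA₀, hA₀s⟩ := Finset.exists_subset_card_eq ha
      obtain ⟨B₀, hB₀, hB₀s⟩ := Finset.exists_subset_card_eq hb
      obtain ⟨C₀, hC₀, hC₀s⟩ := Finset.exists_subset_card_eq hc
      obtain ⟨PA, hPA0, hPA, hPAs⟩ := exists_split r _ A A₀ (by rw [hA]; ring)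
        (hA₀.trans hA₁) hA₀s
      obtain ⟨PB, hPB0, hPB, hPBs⟩ := exists_split r _ B B₀ (by rw [hB]; ring)
        (hB₀.trans hB₁) hB₀s
      obtain ⟨PC, hPC0, hPC, hPCs⟩ := exists_split r _ C C₀ (by rw [hC]; ring)
        (hC₀.trans hC₁) hC₀s
      set I := Finset.range (r + 1) with hI
      have hsum : boxCount R A B C =
          ∑ t ∈ I ×ˢ I ×ˢ I, boxCount R (PA t.1) (PB t.2.1) (PC t.2.2) := by
        rw [Finset.sum_product, boxCount, hPAs]
        refine Finset.sum_congr rfl fun i _ => ?_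
        rw [Finset.sum_product]
        simp only [boxCount]
        simp_rw [hPBs, hPCs]
        rw [Finset.sum_comm]
        refine Finset.sum_congr rfl fun j _ => ?_
        rw [Finset.sum_comm' (t' := PA i) (s' := fun _ => I) (by tauto)]
        refine Finset.sum_congr rfl fun x _ => ?_
        rw [Finset.sum_comm]
      have hzero : boxCount R (PA 0) (PB 0) (PC 0) = 0 := by
        unfold boxCount
        rw [hPA0, hPB0, hPC0]
        refine Finset.sum_eq_zero fun x hx => Finset.sum_eq_zero fun y hy =>
          Finset.sum_eq_zero fun z hz => if_neg (hhole x (hA₀ hx) y (hB₀ hy) z (hC₀ hz))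
      by_contra hno
      have hbound : ∀ t ∈ I ×ˢ I ×ˢ I, boxCount R (PA t.1) (PB t.2.1) (PC t.2.2) ≤
          ((r + 1) ^ 3 - 1) ^ J * q ^ 3 := by
        intro t ht
        simp only [Finset.mem_product, hI, Finset.mem_range] at ht
        by_contra! hlt
        obtain ⟨s, A', B', C', hs, h1, h2, h3, h4⟩ := ih _ _ _ (hPA _ ht.1).2
          (hPB _ ht.2.1).2 (hPC _ ht.2.2).2 hlt
        exact hno ⟨s, A', B', C', hs, h1.trans (hPA _ ht.1).1, h2.trans (hPB _ ht.2.1).1,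
          h3.trans (hPC _ ht.2.2).1, h4⟩
      have h0 : ((0, 0, 0) : ℕ × ℕ × ℕ) ∈ I ×ˢ I ×ˢ I := by simp [hI]
      rw [hsum, ← Finset.add_sum_erase _ _ h0, hzero, zero_add] at h
      refine absurd h (not_lt.2 ?_)
      refine (Finset.sum_le_card_nsmul _ _ _ fun t ht =>
        hbound t (Finset.mem_of_mem_erase ht)).trans ?_
      rw [Finset.card_erase_of_mem h0]
      simp only [Finset.card_product, hI, Finset.card_range, smul_eq_mul]
      apply le_of_eq
      rw [show (r + 1) * ((r + 1) * (r + 1)) = (r + 1) ^ 3 by ring]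
      generalize (r + 1) ^ 3 - 1 = m
      ring

theorem two_mul_hdeg_le_s9 {V : Type*} [Fintype V] [DecidableEq V] (H : Finset (Finset V))
    (hH : ∀ e ∈ H, e.card = 3) (x : V) :
    2 * hdeg H x ≤
      (Finset.univ.filter fun p : V × V => ({p.1, p.2, x} : Finset V) ∈ H).card := by
  have hmaps : ∀ p ∈ Finset.univ.filter fun p : V × V => ({p.1, p.2, x} : Finset V) ∈ H,
      ({p.1, p.2, x} : Finset V) ∈ H.filter fun e => x ∈ e := by
    intro p hp
    simp only [Finset.mem_filter, Finset.mem_univ, true_and] at hp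
    simp [hp]
  rw [Finset.card_eq_sum_card_fiberwise hmaps, hdeg, mul_comm, ← smul_eq_mul]
  refine Finset.card_nsmul_le_sum _ _ _ fun e he => ?_
  rw [Finset.mem_filter] at he
  have h2 : (e.erase x).card = 2 := by rw [Finset.card_erase_of_mem he.2, hH e he.1]
  obtain ⟨y, z, hyz, hez⟩ := Finset.card_eq_two.1 h2
  have hxyz : ({y, z, x} : Finset V) = e := by
    rw [← Finset.insert_erase he.2, hez]
    ext a; simp only [Finset.mem_insert, Finset.mem_singleton]; tauto
  have hxzy : ({z, y, x} : Finset V) = e := by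
    rw [← hxyz]; ext a; simp only [Finset.mem_insert, Finset.mem_singleton]; tauto
  rw [← Finset.card_pair (a := (y, z)) (b := (z, y)) (by simp [hyz])]
  refine Finset.card_le_card ?_
  intro p hp
  simp only [Finset.mem_insert, Finset.mem_singleton] at hp
  rcases hp with rfl | rfl <;> simp [hxyz, hxzy, he.1]

/-- An edge of `H`, with `z` a distinguished vertex, whose weight is at least four times the
average weight up to an error `ρ`, when `z` is counted twice. -/
def HeavyTriple {n : ℕ} (H : Finset (Finset (Fin n))) (u : Fin n → ℝ) (ρ : ℝ)
    (x y z : Fin n) : Prop :=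
  ({x, y, z} : Finset (Fin n)) ∈ H ∧ 4 * (∑ i, u i) / n - ρ ≤ u x + u y + 2 * u z

theorem eIn_le {V : Type*} [Fintype V] [DecidableEq V] (H : Finset (Finset V))
    (hH : ∀ e ∈ H, e.card = 3) (G : Finset (V × V × V)) (B₀ B : Finset V)
    (hG : ∀ x ∈ B₀, ∀ y ∈ B₀, ∀ z ∈ B₀, ({x, y, z} : Finset V) ∈ H → (x, y, z) ∈ G) :
    eIn H B ≤ G.card + (B \ B₀).card * Fintype.card V ^ 2 := by
  have hsub : H.filter (fun e => e ⊆ B) ⊆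
      (G ∪ (B \ B₀) ×ˢ (Finset.univ : Finset V) ×ˢ (Finset.univ : Finset V)).image
        fun p => ({p.1, p.2.1, p.2.2} : Finset V) := by
    intro e he
    rw [Finset.mem_filter] at he
    rw [Finset.mem_image]
    by_cases h : e ⊆ B₀
    · obtain ⟨x, y, z, -, -, -, rfl⟩ := Finset.card_eq_three.1 (hH e he.1)
      exact ⟨(x, y, z), Finset.mem_union_left _
        (hG x (h (by simp)) y (h (by simp)) z (h (by simp)) he.1), rfl⟩
    · obtain ⟨x, hx, hxB⟩ := Finset.not_subset.1 h
      have h2 : (e.erase x).card = 2 := by rw [Finset.card_erase_of_mem hx, hH e he.1]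
      obtain ⟨y, z, hyz, hez⟩ := Finset.card_eq_two.1 h2
      refine ⟨(x, y, z), Finset.mem_union_right _ ?_, ?_⟩
      · simp [he.2 hx, hxB]
      · rw [← Finset.insert_erase hx, hez]
  refine (Finset.card_le_card hsub).trans (Finset.card_image_le.trans
    ((Finset.card_union_le _ _).trans ?_))
  simp [sq]

theorem exists_heavyTriples {γ ρ : ℝ} (hγ : 0 < γ) (hρ : 0 < ρ) (hρ1 : ρ ≤ 1) :
    ∃ η : ℝ, 0 < η ∧ ∃ n₀ : ℕ, ∀ n > n₀, ∀ H : Finset (Finset (Fin n)),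
      (∀ e ∈ H, e.card = 3) →
      (∀ x : Fin n, (7 / 16 - γ) * (n.choose 2 : ℝ) ≤ (hdeg H x : ℝ)) →
      ¬ BetaExtremal (2050 * γ) n H →
      ∀ u : Fin n → ℝ, (∀ x, 0 ≤ u x) → (∀ x, u x ≤ 1) →
      ∃ G : Finset (Fin n × Fin n × Fin n), η * (n : ℝ) ^ 3 ≤ G.card ∧
        ∀ p, p ∈ G ↔ HeavyTriple H u ρ p.1 p.2.1 p.2.2 := by
  classical
  refine ⟨γ * ρ / 32, by positivity, ⌈16 / ρ⌉₊ + ⌈1 / γ⌉₊, ?_⟩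
  intro n hn H hH hdegH hext u hu0 hu1
  have hnρ : 16 / ρ < n := (Nat.le_ceil _).trans_lt (by exact_mod_cast (by omega))
  have hnγ : 1 / γ < n := (Nat.le_ceil _).trans_lt (by exact_mod_cast (by omega))
  have hn0 : (0 : ℝ) < n := (by positivity : (0 : ℝ) < 1 / γ).trans hnγ
  rw [div_lt_iff₀ hρ] at hnρ
  rw [div_lt_iff₀ hγ] at hnγ
  refine ⟨Finset.univ.filter fun p => HeavyTriple H u ρ p.1 p.2.1 p.2.2, ?_, by simp⟩
  set G := Finset.univ.filter fun p : Fin n × Fin n × Fin n =>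
    HeavyTriple H u ρ p.1 p.2.1 p.2.2 with hG
  by_contra! hfew
  set k := ⌈ρ * n / 16⌉₊ with hk
  have hk1 : ρ * n / 16 ≤ k := Nat.le_ceil _
  have hk2 : (k : ℝ) < ρ * n / 4 := by
    have := Nat.ceil_lt_add_one (by positivity : 0 ≤ ρ * n / 16)
    linarith
  have hkpos : (0 : ℝ) < k := (by positivity : 0 < ρ * n / 16).trans_le hk1
  have hkn : k ≤ (Finset.univ : Finset (Fin n)).card := by
    rw [Finset.card_univ, Fintype.card_fin]
    have : (k : ℝ) ≤ n := by nlinarith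
    exact_mod_cast this
  obtain ⟨S, -, hS, htop⟩ := exists_top_subset Finset.univ u hkn
  have hSne : S.Nonempty := by
    rw [← Finset.card_pos, hS]; exact_mod_cast hkpos
  obtain ⟨s₀, hs₀, hmin⟩ := Finset.exists_min_image S u hSne
  set u₀ := u s₀ with hu₀
  set v : Fin n → ℝ := fun x => max (u₀ - u x) 0 with hv
  set t := 4 * (u₀ - (∑ i, u i) / n) + ρ with ht
  have hvsum : ∑ x, v x ≤ n * u₀ - ∑ x, u x + k := by
    have h1 : ∀ x, v x ≤ u₀ - u x + if x ∈ S then 1 else 0 := by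
      intro x
      simp only [hv]
      split_ifs with hx
      · have := hmin x hx
        have := hu1 x
        have := hu0 s₀
        exact max_le (by linarith) (by linarith)
      · have := htop s₀ hs₀ x (by simp [hx])
        exact max_le (by linarith) (by linarith)
    refine (Finset.sum_le_sum fun x _ => h1 x).trans (le_of_eq ?_)
    rw [Finset.sum_add_distrib, Finset.sum_sub_distrib]
    simp [hS]
  have hnt : n * t / 4 = n * u₀ - ∑ x, u x + ρ * n / 4 := by
    rw [ht]; field_simp
  have hvt : ∑ x, v x ≤ n * t / 4 := by linarith
  have htpos : 0 < t := by
    have h0 : 0 ≤ ∑ x, v x := Finset.sum_nonneg fun x _ => le_max_right _ _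
    have : 0 < n * t / 4 := by linarith
    by_contra! hle
    nlinarith
  obtain ⟨x, hxS, hx⟩ : ∃ x ∈ S, ((Finset.univ.filter fun p : Fin n × Fin n =>
      HeavyTriple H u ρ p.1 p.2 x).card : ℝ) ≤ γ / 2 * (n : ℝ) ^ 2 := by
    by_contra! hall
    have h1 : ∑ x ∈ S, (Finset.univ.filter fun p : Fin n × Fin n =>
        HeavyTriple H u ρ p.1 p.2 x).card ≤ G.card := by
      rw [← Finset.card_sigma]
      refine Finset.card_le_card_of_injOn (fun q => (q.2.1, q.2.2, q.1)) ?_ ?_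
      · rintro ⟨x, y, z⟩ hq
        simp only [Finset.coe_sigma, Set.mem_sigma_iff, Finset.mem_coe, Finset.mem_filter] at hq
        simp [hG, hq.2.2]
      · rintro ⟨x, y, z⟩ _ ⟨x', y', z'⟩ _ h
        simp only [Prod.mk.injEq] at h
        obtain ⟨rfl, rfl, rfl⟩ := h
        rfl
    have h2 : (k : ℝ) * (γ / 2 * (n : ℝ) ^ 2) ≤ G.card := by
      refine le_trans ?_ (Nat.cast_le.2 h1)
      rw [← hS, ← nsmul_eq_mul]
      push_cast
      exact Finset.card_nsmul_le_sum _ _ _ fun x hx => (hall x hx).le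
    have h3 : ρ * n / 16 * (γ / 2 * (n : ℝ) ^ 2) ≤ k * (γ / 2 * (n : ℝ) ^ 2) := by gcongr
    have h4 : γ * ρ / 32 * (n : ℝ) ^ 3 = ρ * n / 16 * (γ / 2 * (n : ℝ) ^ 2) := by ring
    linarith
  have hpairs : (7 / 16 - 2 * γ) * (n : ℝ) ^ 2 ≤
      ((Finset.univ.filter fun p : Fin n × Fin n => t < v p.1 + v p.2).card : ℝ) := by
    have hsub : (Finset.univ.filter fun p : Fin n × Fin n =>
        ({p.1, p.2, x} : Finset (Fin n)) ∈ H) ⊆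
        (Finset.univ.filter fun p : Fin n × Fin n => HeavyTriple H u ρ p.1 p.2 x) ∪
        Finset.univ.filter fun p : Fin n × Fin n => t < v p.1 + v p.2 := by
      rintro ⟨y, z⟩ hp
      simp only [Finset.mem_filter, Finset.mem_univ, true_and, Finset.mem_union] at hp ⊢
      by_cases h : HeavyTriple H u ρ y z x
      · exact Or.inl h
      · right
        have h1 : u y + u z + 2 * u x < 4 * (∑ i, u i) / n - ρ := by
          by_contra! hc
          exact h ⟨hp, hc⟩
        have h2 := hmin x hxS
        have h3 : u₀ - u y ≤ v y := le_max_left _ _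
        have h4 : u₀ - u z ≤ v z := le_max_left _ _
        rw [ht]
        rw [mul_div_assoc] at h1
        linarith
    have h1 := (Finset.card_le_card hsub).trans (Finset.card_union_le _ _)
    have h2 := (two_mul_hdeg_le_s9 H hH x).trans h1
    have h3 : 2 * (hdeg H x : ℝ) ≤ ((Finset.univ.filter fun p : Fin n × Fin n =>
        HeavyTriple H u ρ p.1 p.2 x).card : ℝ) +
        ((Finset.univ.filter fun p : Fin n × Fin n => t < v p.1 + v p.2).card : ℝ) := by
      exact_mod_cast h2
    have h4 := hdegH x
    rw [Nat.cast_choose_two] at h4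
    nlinarith
  have hheavy := card_heavy_le v (fun x => le_max_right _ _) htpos
    (by positivity : 0 ≤ 2 * γ) (by rw [Fintype.card_fin]; exact hvt)
    (by rw [Fintype.card_fin]; exact hpairs)
  rw [Fintype.card_fin] at hheavy
  set B₀ := Finset.univ.filter fun x => ¬ t / 4 ≤ v x with hB₀
  have hB₀card : (3 / 4 - 16 * γ) * n ≤ B₀.card := by
    have h1 := Finset.card_filter_add_card_filter_not (s := (Finset.univ : Finset (Fin n)))
      (fun x => t / 4 ≤ v x)
    rw [Finset.card_univ, Fintype.card_fin] at h1
    have h2 : ((Finset.univ.filter fun x => t / 4 ≤ v x).card : ℝ) + B₀.card = n := by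
      exact_mod_cast h1
    linarith
  have hB₀G : ∀ x ∈ B₀, ∀ y ∈ B₀, ∀ z ∈ B₀, ({x, y, z} : Finset (Fin n)) ∈ H →
      (x, y, z) ∈ G := by
    intro x hx y hy z hz hxyz
    simp only [hB₀, Finset.mem_filter, Finset.mem_univ, true_and, not_le] at hx hy hz
    have h1 : u₀ - u x ≤ v x := le_max_left _ _
    have h2 : u₀ - u y ≤ v y := le_max_left _ _
    have h3 : u₀ - u z ≤ v z := le_max_left _ _
    simp only [hG, Finset.mem_filter, Finset.mem_univ, true_and]
    refine ⟨hxyz, ?_⟩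
    rw [mul_div_assoc]
    linarith
  have hfin : ∀ B : Finset (Fin n), B.card = 3 * n / 4 →
      ((B \ B₀).card : ℝ) ≤ 16 * γ * n → False := by
    intro B hB hBB
    refine hext ⟨B, hB, ?_⟩
    have h1 := eIn_le H hH G B₀ B hB₀G
    rw [Fintype.card_fin] at h1
    have h2 : (eIn H B : ℝ) ≤ G.card + (B \ B₀).card * (n : ℝ) ^ 2 := by exact_mod_cast h1
    have h3 : ((B \ B₀).card : ℝ) * (n : ℝ) ^ 2 ≤ 16 * γ * n * (n : ℝ) ^ 2 := by gcongr
    have h4 : γ * ρ * (n : ℝ) ^ 3 ≤ γ * 1 * (n : ℝ) ^ 3 := by gcongr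
    have h5 : 0 < γ * (n : ℝ) ^ 3 := by positivity
    nlinarith
  rcases le_total (3 * n / 4) B₀.card with h | h
  · obtain ⟨B, hBsub, hB⟩ := Finset.exists_subset_card_eq h
    exact hfin B hB (by rw [Finset.sdiff_eq_empty_iff_subset.2 hBsub]; simp; positivity)
  · obtain ⟨B, hBsub, hB⟩ := Finset.exists_superset_card_eq h (by
      rw [Fintype.card_fin]; omega)
    refine hfin B hB ?_
    rw [Finset.card_sdiff_of_subset hBsub, Nat.cast_sub (hB ▸ h), hB]
    have h1 : ((3 * n / 4 : ℕ) : ℝ) ≤ 3 * n / 4 := by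
      have := Nat.cast_div_le (α := ℝ) (m := 3 * n) (n := 4)
      push_cast at this
      exact this
    linarith

theorem boxCount_eq_card {V : Type*} (R : V → V → V → Prop) [∀ x y z, Decidable (R x y z)]
    (A B C : Finset V) :
    boxCount R A B C = ((A ×ˢ B ×ˢ C).filter fun p => R p.1 p.2.1 p.2.2).card := by
  rw [boxCount, Finset.card_filter, Finset.sum_product]
  simp_rw [Finset.sum_product]

theorem card_le_boxCount_add {V : Type*} [Fintype V] [DecidableEq V] (R : V → V → V → Prop)
    [∀ x y z, Decidable (R x y z)] (G : Finset (V × V × V))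
    (hG : ∀ p ∈ G, R p.1 p.2.1 p.2.2) (S : Finset V) :
    G.card ≤ boxCount R S S S + 3 * (Sᶜ.card * Fintype.card V ^ 2) := by
  have hsub : G ⊆ ((S ×ˢ S ×ˢ S).filter fun p => R p.1 p.2.1 p.2.2) ∪
      (Sᶜ ×ˢ Finset.univ ×ˢ Finset.univ ∪ (Finset.univ ×ˢ Sᶜ ×ˢ Finset.univ ∪
        Finset.univ ×ˢ Finset.univ ×ˢ Sᶜ)) := by
    rintro ⟨x, y, z⟩ hp
    have := hG _ hp
    simp only [Finset.mem_union, Finset.mem_filter, Finset.mem_product, Finset.mem_compl,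
      Finset.mem_univ, true_and, and_true]
    tauto
  have h1 := (Finset.card_le_card hsub).trans (Finset.card_union_le _ _)
  rw [← boxCount_eq_card] at h1
  refine h1.trans (Nat.add_le_add_left ?_ _)
  refine (Finset.card_union_le _ _).trans
    ((Nat.add_le_add_left (Finset.card_union_le _ _) _).trans (le_of_eq ?_))
  simp only [Finset.card_product, Finset.card_univ]
  ring

theorem exists_mul_le_sum {V : Type*} [DecidableEq V] (A : Finset V) (u : V → ℝ)
    (hu : ∀ x, 0 ≤ u x) {s m : ℕ} (hA : A.card = m) (hs : s ≤ m) :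
    ∃ T ⊆ A, T.card = s ∧ ∀ x ∈ T, ((m : ℝ) - s) * u x ≤ ∑ y ∈ A, u y := by
  obtain ⟨T, hTA, hT, hlow⟩ := exists_top_subset A (fun x => -u x) (hA ▸ hs)
  refine ⟨T, hTA, hT, fun x hx => ?_⟩
  have h1 : ((A \ T).card : ℝ) = m - s := by
    rw [Finset.card_sdiff_of_subset hTA, hA, hT, Nat.cast_sub hs]
  rw [← h1, ← nsmul_eq_mul]
  refine (Finset.card_nsmul_le_sum _ _ _ fun y hy => ?_).trans
    (Finset.sum_le_sum_of_subset_of_nonneg Finset.sdiff_subset fun y _ _ => hu y)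
  have := hlow x hx y hy
  linarith

/-- In a non-extremal 3-graph of large minimum degree, every weight function admits a
lower-regular triple of linear size on which its average is almost at least its global average. -/
theorem exists_tile {γ ρ : ℝ} (hγ : 0 < γ) (hρ : 0 < ρ) (hρ1 : ρ ≤ 1 / 2) {r : ℕ}
    (hr : 2 / ρ ≤ r) :
    ∃ c : ℝ, 0 < c ∧ ∃ n₀ : ℕ, ∀ n > n₀, ∀ H : Finset (Finset (Fin n)),
      (∀ e ∈ H, e.card = 3) →
      (∀ x : Fin n, (7 / 16 - γ) * (n.choose 2 : ℝ) ≤ (hdeg H x : ℝ)) →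
      ¬ BetaExtremal (2050 * γ) n H →
      ∀ u : Fin n → ℝ, (∀ x, 0 ≤ u x) → (∀ x, u x ≤ 1) →
      ∃ (s : ℕ) (A B C : Finset (Fin n)), c * n ≤ s ∧ A.card = r * s ∧ B.card = r * s ∧
        C.card = 2 * (r * s) ∧ Disjoint A B ∧ Disjoint A C ∧ Disjoint B C ∧
        LowerRegular (fun x y z => ({x, y, z} : Finset (Fin n)) ∈ H) s A B C ∧
        4 * (r * s : ℝ) * ((∑ x, u x) / n - ρ) ≤
          ∑ x ∈ A, u x + ∑ x ∈ B, u x + ∑ x ∈ C, u x := by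
  classical
  obtain ⟨η, hη, n₁, hn₁⟩ := exists_heavyTriples hγ (by positivity : 0 < 2 * ρ) (by linarith)
  have hr0 : (0 : ℝ) < r := (by positivity : 0 < 2 / ρ).trans_le hr
  have hrpos : 0 < r := by exact_mod_cast hr0
  set b := 4 * r with hb
  have hb1 : b - 1 + 1 = b := by omega
  have hbR : (1 : ℝ) ≤ (b : ℝ) ^ 3 := by
    apply one_le_pow₀
    exact_mod_cast (by omega : 1 ≤ b)
  obtain ⟨J, hJ⟩ := exists_pow_lt_of_lt_one (by positivity : 0 < η / 2)
    (show 1 - 1 / (b : ℝ) ^ 3 < 1 by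
      have : 0 < 1 / (b : ℝ) ^ 3 := by positivity
      linarith)
  set L := b ^ J with hL
  have hLpos : 0 < L := by positivity
  refine ⟨1 / (2 * L), by positivity, n₁ + 2 * L + ⌈6 * L / η⌉₊, ?_⟩
  intro n hn H hH hdegH hext u hu0 hu1
  obtain ⟨G, hGcard, hG⟩ := hn₁ n (by omega) H hH hdegH hext u hu0 hu1
  have hnη : 6 * L / η < n := (Nat.le_ceil _).trans_lt
    (Nat.cast_lt.2 (by omega))
  rw [div_lt_iff₀ hη] at hnη
  have hn2 : 2 * L ≤ n := by omega
  have hnpos : (0 : ℝ) < n := by exact_mod_cast (by omega)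
  set q := n / L with hq
  have hqn : L * q ≤ n := Nat.mul_div_le n L
  have hqn' : n < L * q + L := by
    have := Nat.lt_mul_div_succ n hLpos
    rwa [← hq, mul_add, mul_one] at this
  obtain ⟨S, -, hS⟩ := Finset.exists_subset_card_eq (s := (Finset.univ : Finset (Fin n)))
    (n := L * q) (by simpa using hqn)
  have hScompl : Sᶜ.card ≤ L := by
    rw [Finset.card_compl, Fintype.card_fin, hS]; omega
  have hbox : ((b - 1 + 1) ^ 3 - 1) ^ J * q ^ 3 < boxCount (HeavyTriple H u (2 * ρ)) S S S := by
    have h1 := card_le_boxCount_add (HeavyTriple H u (2 * ρ)) G (fun p hp => (hG p).1 hp) S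
    rw [Fintype.card_fin] at h1
    have h2 : (G.card : ℝ) ≤ boxCount (HeavyTriple H u (2 * ρ)) S S S +
        3 * (L * (n : ℝ) ^ 2) := by
      have : G.card ≤ boxCount (HeavyTriple H u (2 * ρ)) S S S + 3 * (L * n ^ 2) :=
        h1.trans (by gcongr)
      exact_mod_cast this
    have h3 : (((b - 1 + 1) ^ 3 - 1 : ℕ) : ℝ) = (b : ℝ) ^ 3 * (1 - 1 / (b : ℝ) ^ 3) := by
      rw [hb1, Nat.cast_sub (Nat.one_le_pow _ _ (by omega))]
      push_cast
      rw [mul_sub, mul_one, mul_one_div_cancel (by positivity)]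
    have h4 : ((L * q : ℕ) : ℝ) ≤ n := by exact_mod_cast hqn
    have h5 : (((b : ℝ) ^ 3 * (1 - 1 / (b : ℝ) ^ 3)) ^ J * (q : ℝ) ^ 3) =
        (1 - 1 / (b : ℝ) ^ 3) ^ J * ((L * q : ℕ) : ℝ) ^ 3 := by
      rw [hL]; push_cast; rw [mul_pow, mul_pow, ← pow_mul, ← pow_mul]; ring
    have h6 : (1 - 1 / (b : ℝ) ^ 3) ^ J * ((L * q : ℕ) : ℝ) ^ 3 ≤ η / 2 * (n : ℝ) ^ 3 := by
      gcongr
    have h7 : 3 * (L * (n : ℝ) ^ 2) < η / 2 * (n : ℝ) ^ 3 := by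
      have : 0 < (n : ℝ) ^ 2 := by positivity
      nlinarith
    have h8 : (((((b - 1 + 1) ^ 3 - 1) ^ J * q ^ 3 : ℕ)) : ℝ) <
        boxCount (HeavyTriple H u (2 * ρ)) S S S := by
      rw [Nat.cast_mul, Nat.cast_pow, Nat.cast_pow, h3, h5]
      linarith
    exact_mod_cast h8
  obtain ⟨s, A₀, B₀, C₀, hqs, -, -, -, hA₀, hB₀, hC₀, hreg⟩ :=
    exists_lowerRegular (HeavyTriple H u (2 * ρ)) (b - 1) q J S S S (by rw [hb1, hS])
      (by rw [hb1, hS]) (by rw [hb1, hS]) hbox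
  rw [hb1, hb, mul_assoc] at hA₀ hB₀ hC₀
  set m := r * s with hm
  obtain ⟨A, hA, hAm⟩ := Finset.exists_subset_card_eq (s := A₀) (n := m) (by omega)
  obtain ⟨B, hB, hBm⟩ := Finset.exists_subset_card_eq (s := B₀ \ A) (n := m) (by
    have := Finset.le_card_sdiff A B₀
    omega)
  obtain ⟨C, hC, hCm⟩ := Finset.exists_subset_card_eq (s := C₀ \ (A ∪ B)) (n := 2 * m) (by
    have := Finset.le_card_sdiff (A ∪ B) C₀
    have := Finset.card_union_le A B
    omega)
  have hsm : s ≤ m := Nat.le_mul_of_pos_left _ hrpos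
  have hreg' := hreg.mono (fun _ _ _ h => h) hA (hB.trans Finset.sdiff_subset)
    (hC.trans Finset.sdiff_subset)
  refine ⟨s, A, B, C, ?_, hAm, hBm, hCm, ?_, ?_, ?_, hreg'.mono (fun _ _ _ h => h.1)
    subset_rfl subset_rfl subset_rfl, ?_⟩
  · have h1 : (n : ℝ) < L * q + L := by exact_mod_cast hqn'
    have h2 : (q : ℝ) ≤ s := by exact_mod_cast hqs
    have h3 : (2 : ℝ) * L ≤ n := by exact_mod_cast hn2
    have hL0 : (0 : ℝ) < L := by exact_mod_cast hLpos
    rw [one_div, inv_mul_le_iff₀ (by positivity)]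
    nlinarith
  · exact (Finset.disjoint_sdiff.mono_right hB)
  · exact Finset.disjoint_sdiff.mono (Finset.subset_union_left) hC
  · exact Finset.disjoint_sdiff.mono (Finset.subset_union_right) hC
  · obtain ⟨TA, hTA, hTAs, hlA⟩ := exists_mul_le_sum A u hu0 hAm hsm
    obtain ⟨TB, hTB, hTBs, hlB⟩ := exists_mul_le_sum B u hu0 hBm hsm
    obtain ⟨TC, hTC, hTCs, hlC⟩ := exists_mul_le_sum C u hu0 hCm (by omega : s ≤ 2 * m)
    obtain ⟨x, hx, y, hy, z, hz, -, hxyz⟩ :=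
      hreg' TA hTA TB hTB TC hTC hTAs.ge hTBs.ge hTCs.ge
    have hx' := hlA x hx
    have hy' := hlB y hy
    have hz' := hlC z hz
    have havg : (∑ i, u i) / n ≤ 1 := by
      rw [div_le_one hnpos]
      refine (Finset.sum_le_sum fun i _ => hu1 i).trans (by simp)
    rw [mul_div_assoc] at hxyz
    set a := (∑ i, u i) / n
    have hmR : (m : ℝ) = r * s := by rw [hm]; push_cast; ring
    have hsR : (s : ℝ) ≤ m := by exact_mod_cast hsm
    have h1 : ((m : ℝ) - s) * (4 * a - 2 * ρ) ≤ (m - s) * (u x + u y + 2 * u z) :=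
      mul_le_mul_of_nonneg_left hxyz (by linarith)
    have h2 : 2 * (s : ℝ) ≤ ρ * m := by
      rw [hmR]
      rw [div_le_iff₀ hρ] at hr
      nlinarith [(Nat.cast_nonneg s : (0 : ℝ) ≤ s)]
    have h3 : (s : ℝ) * (4 * a - 2 * ρ) ≤ s * 4 :=
      mul_le_mul_of_nonneg_left (by linarith) (Nat.cast_nonneg s)
    have h4 : 0 ≤ (s : ℝ) * u z := mul_nonneg (Nat.cast_nonneg s) (hu0 z)
    push_cast at hz'
    rw [← hmR]
    nlinarith

/-- A state of a depth-first search for a long loose path whose joints alternate between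
`P false` and `P true` and whose remaining vertices lie in `C`. The sets `U b` and `W` consist of
the unexplored vertices, and `X b` of the joints that have been abandoned. -/
structure PathSearch {V : Type*} [DecidableEq V] (H : Finset (Finset V)) (P : Bool → Finset V)
    (C : Finset V) (s k : ℕ) (v : ℕ → V) (U X : Bool → Finset V) (W : Finset V) : Prop where
  path : IsLoosePath H k v
  joint : ∀ i ≤ k, v (2 * i) ∈ P i.bodd
  mid : ∀ i < k, v (2 * i + 1) ∈ C
  notMem_W : ∀ j ≤ 2 * k, v j ∉ W
  notMem_U : ∀ j ≤ 2 * k, ∀ b, v j ∉ U b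
  notMem_X : ∀ j ≤ 2 * k, ∀ b, v j ∉ X b
  U_subset : ∀ b, U b ⊆ P b
  X_subset : ∀ b, X b ⊆ P b
  W_subset : W ⊆ C
  not_link : ∀ b, ∀ x ∈ X b, ∀ c ∈ W, ∀ y ∈ U !b, ({x, c, y} : Finset V) ∉ H
  disj : ∀ b b', Disjoint (X b) (U b')
  card_X : ∀ b, (X b).card ≤ s
  card_false : (P false).card ≤ (U false).card + (X false).card + k / 2 + 1
  card_true : (P true).card ≤ (U true).card + (X true).card + (k + 1) / 2
  card_C : C.card ≤ W.card + (X false).card + (X true).card + k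

namespace PathSearch

variable {V : Type*} [DecidableEq V] {H : Finset (Finset V)} {P : Bool → Finset V}
  {C : Finset V} {s k : ℕ} {v : ℕ → V} {U X : Bool → Finset V} {W : Finset V}

theorem card_X_lt (S : PathSearch H P C s k v U X W)
    (hreg : ∀ b, ∀ X ⊆ P b, ∀ W ⊆ C, ∀ Y ⊆ P !b, s ≤ X.card → s ≤ W.card → s ≤ Y.card →
      ∃ x ∈ X, ∃ c ∈ W, ∃ y ∈ Y, ({x, c, y} : Finset V) ∈ H)
    (hU : ∀ b, s ≤ (U b).card) (hW : s ≤ W.card) (b : Bool) : (X b).card < s := by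
  by_contra! h
  obtain ⟨x, hx, c, hc, y, hy, he⟩ := hreg b _ (S.X_subset b) _ S.W_subset _ (S.U_subset !b)
    h hW (hU _)
  exact S.not_link b x hx c hc y hy he

/-- Append two unexplored vertices to the path. -/
theorem extend (S : PathSearch H P C s k v U X W) (hPC : ∀ b, Disjoint (P b) C)
    (hPP : ∀ b, Disjoint (P b) (P !b))
    {c y : V} (hc : c ∈ W) (hy : y ∈ U !k.bodd)
    (he : ({v (2 * k), c, y} : Finset V) ∈ H) :
    PathSearch H P C s (k + 1) (Function.update (Function.update v (2 * k + 1) c) (2 * k + 2) y)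
      (Function.update U (!k.bodd) ((U !k.bodd).erase y)) X (W.erase c) := by
  set v' := Function.update (Function.update v (2 * k + 1) c) (2 * k + 2) y with hv'
  set U' := Function.update U (!k.bodd) ((U !k.bodd).erase y) with hU'
  have hold : ∀ j ≤ 2 * k, v' j = v j := fun j hj => by
    rw [hv', Function.update_of_ne (by omega), Function.update_of_ne (by omega)]
  have hvc : v' (2 * k + 1) = c := by
    rw [hv', Function.update_of_ne (by omega), Function.update_self]
  have hvy : v' (2 * k + 2) = y := by rw [hv', Function.update_self]
  have hUU : ∀ b, U' b ⊆ U b := by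
    intro b
    by_cases hb : b = !k.bodd
    · subst hb; rw [hU', Function.update_self]; exact Finset.erase_subset _ _
    · rw [hU', Function.update_of_ne hb]
  have hcU : ∀ b, c ∉ U b := fun b h =>
    Finset.disjoint_left.1 (hPC b) (S.U_subset b h) (S.W_subset hc)
  have hcX : ∀ b, c ∉ X b := fun b h =>
    Finset.disjoint_left.1 (hPC b) (S.X_subset b h) (S.W_subset hc)
  have hyP := S.U_subset _ hy
  have hyc : y ≠ c := fun h => hcU _ (h ▸ hy)
  have hyW : y ∉ W := fun h => Finset.disjoint_left.1 (hPC _) hyP (S.W_subset h)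
  have hcases : ∀ j ≤ 2 * (k + 1), j ≤ 2 * k ∨ j = 2 * k + 1 ∨ j = 2 * k + 2 := by omega
  have hcard : (U' (!k.bodd)).card + 1 = (U !k.bodd).card := by
    rw [hU', Function.update_self]; exact Finset.card_erase_add_one hy
  have hcard' : U' k.bodd = U k.bodd := by
    rw [hU', Function.update_of_ne]; cases k.bodd <;> simp
  have hcardW := Finset.card_erase_add_one hc
  have hk : 2 * (k + 1) = 2 * k + 2 := by ring
  have hbodd := Nat.mod_two_of_bodd k
  refine ⟨⟨?_, ?_⟩, ?_, ?_, ?_, ?_, ?_, fun b => (hUU b).trans (S.U_subset b), S.X_subset,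
    (Finset.erase_subset _ _).trans S.W_subset, ?_, ?_, S.card_X, ?_, ?_, ?_⟩
  · intro i hi j hj hij
    simp only [Set.mem_Iio] at hi hj
    have hinj := S.path.1
    rcases hcases i (by omega) with h | h | h <;> rcases hcases j (by omega) with h' | h' | h'
    · rw [hold i h, hold j h'] at hij
      exact hinj (Set.mem_Iio.2 (by omega)) (Set.mem_Iio.2 (by omega)) hij
    · rw [hold i h, h', hvc] at hij
      exact absurd (hij ▸ hc) (S.notMem_W i h)
    · rw [hold i h, h', hvy] at hij
      exact absurd (hij ▸ hy) (S.notMem_U i h _)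
    · rw [hold j h', h, hvc] at hij
      exact absurd (hij.symm ▸ hc) (S.notMem_W j h')
    · omega
    · rw [h, h', hvc, hvy] at hij; exact absurd hij.symm hyc
    · rw [hold j h', h, hvy] at hij
      exact absurd (hij.symm ▸ hy) (S.notMem_U j h' _)
    · rw [h, h', hvc, hvy] at hij; exact absurd hij hyc
    · omega
  · intro i hi
    rcases Nat.lt_succ_iff_lt_or_eq.1 hi with h | rfl
    · rw [hold _ (by omega), hold _ (by omega), hold _ (by omega)]
      exact S.path.2 i h
    · rw [hold _ le_rfl, hvc, hvy]; exact he
  · intro i hi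
    rcases Nat.le_succ_iff.1 hi with h | rfl
    · rw [hold _ (by omega)]; exact S.joint i h
    · rw [Nat.succ_eq_add_one, hk, hvy, Nat.bodd_succ]; exact hyP
  · intro i hi
    rcases Nat.lt_succ_iff_lt_or_eq.1 hi with h | rfl
    · rw [hold _ (by omega)]; exact S.mid i h
    · rw [hvc]; exact S.W_subset hc
  · intro j hj
    rcases hcases j hj with h | rfl | rfl
    · rw [hold j h]; exact fun h' => S.notMem_W j h (Finset.mem_of_mem_erase h')
    · rw [hvc]; exact Finset.notMem_erase _ _
    · rw [hvy]; exact fun h' => hyW (Finset.mem_of_mem_erase h')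
  · intro j hj b
    rcases hcases j hj with h | rfl | rfl
    · rw [hold j h]; exact fun h' => S.notMem_U j h b (hUU b h')
    · rw [hvc]; exact fun h' => hcU b (hUU b h')
    · rw [hvy]
      by_cases hb : b = !k.bodd
      · subst hb; rw [hU', Function.update_self]; exact Finset.notMem_erase _ _
      · have hb' : b = k.bodd := by revert hb; cases b <;> cases k.bodd <;> simp
        exact fun h' => Finset.disjoint_left.1 (hPP b) (S.U_subset b (hUU b h')) (hb' ▸ hyP)
  · intro j hj b
    rcases hcases j hj with h | rfl | rfl
    · rw [hold j h]; exact S.notMem_X j h b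
    · rw [hvc]; exact hcX b
    · rw [hvy]; exact fun h' => Finset.disjoint_left.1 (S.disj b _) h' hy
  · intro b x hx d hd z hz
    exact S.not_link b x hx d (Finset.mem_of_mem_erase hd) z (hUU _ hz)
  · exact fun b b' => (S.disj b b').mono_right (hUU b')
  · have h1 := S.card_false
    cases hb : k.bodd <;> rw [hb] at hcard hcard' hbodd <;>
      simp only [Bool.not_true, Bool.not_false, Bool.toNat_true, Bool.toNat_false]
        at hcard hcard' hbodd <;> [rw [hcard']; skip] <;> omega
  · have h1 := S.card_true
    cases hb : k.bodd <;> rw [hb] at hcard hcard' hbodd <;>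
      simp only [Bool.not_true, Bool.not_false, Bool.toNat_true, Bool.toNat_false]
        at hcard hcard' hbodd <;> [skip; rw [hcard']] <;> omega
  · have h1 := S.card_C
    omega

/-- Abandon the last joint of a path that cannot be extended. -/
theorem pop (S : PathSearch H P C s (k + 1) v U X W)
    (hX : (X (k + 1).bodd).card < s)
    (hlink : ∀ c ∈ W, ∀ y ∈ U !(k + 1).bodd, ({v (2 * (k + 1)), c, y} : Finset V) ∉ H) :
    PathSearch H P C s k v U
      (Function.update X (k + 1).bodd (insert (v (2 * (k + 1))) (X (k + 1).bodd))) W := by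
  set b₀ := (k + 1).bodd with hb₀
  set x := v (2 * (k + 1)) with hx
  set X' := Function.update X b₀ (insert x (X b₀)) with hX'
  have hmem : ∀ b z, z ∈ X' b → z ∈ X b ∨ (b = b₀ ∧ z = x) := by
    intro b z hz
    by_cases hb : b = b₀
    · subst hb
      rw [hX', Function.update_self, Finset.mem_insert] at hz
      tauto
    · rw [hX', Function.update_of_ne hb] at hz
      exact Or.inl hz
  have hxX : x ∉ X b₀ := S.notMem_X _ le_rfl _
  have hxP : x ∈ P b₀ := S.joint (k + 1) le_rfl
  have hcard : (X' b₀).card = (X b₀).card + 1 := by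
    rw [hX', Function.update_self, Finset.card_insert_of_notMem hxX]
  have hcard' : X' (!b₀) = X (!b₀) := by
    rw [hX', Function.update_of_ne]; cases b₀ <;> simp
  have hbodd := Nat.mod_two_of_bodd (k + 1)
  rw [← hb₀] at hbodd
  have h1 := S.card_false
  have h2 := S.card_true
  have h3 := S.card_C
  refine ⟨⟨S.path.1.mono fun j hj => ?_, fun i hi => S.path.2 i (by omega)⟩,
    fun i hi => S.joint i (by omega), fun i hi => S.mid i (by omega),
    fun j hj => S.notMem_W j (by omega), fun j hj => S.notMem_U j (by omega), ?_, S.U_subset,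
    ?_, S.W_subset, ?_, ?_, ?_, ?_, ?_, ?_⟩
  · simp only [Set.mem_Iio] at hj ⊢; omega
  · intro j hj b h
    rcases hmem b _ h with h | ⟨-, h⟩
    · exact S.notMem_X j (by omega) b h
    · have := S.path.1 (Set.mem_Iio.2 (by omega)) (Set.mem_Iio.2 (by omega)) h
      omega
  · intro b z hz
    rcases hmem b z hz with h | ⟨rfl, rfl⟩
    · exact S.X_subset b h
    · exact hxP
  · intro b z hz c hc y hy
    rcases hmem b z hz with h | ⟨rfl, rfl⟩
    · exact S.not_link b z h c hc y hy
    · exact hlink c hc y hy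
  · intro b b'
    rw [Finset.disjoint_left]
    intro z hz
    rcases hmem b z hz with h | ⟨-, rfl⟩
    · exact Finset.disjoint_left.1 (S.disj b b') h
    · exact S.notMem_U _ le_rfl b'
  · intro b
    by_cases hb : b = b₀
    · subst hb; omega
    · rw [hX', Function.update_of_ne hb]; exact S.card_X b
  · cases hb : b₀ <;> rw [hb] at hcard hcard' hbodd <;>
      simp only [Bool.not_true, Bool.not_false, Bool.toNat_true, Bool.toNat_false]
        at hcard hcard' hbodd <;> [skip; rw [hcard']] <;> omega
  · cases hb : b₀ <;> rw [hb] at hcard hcard' hbodd <;>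
      simp only [Bool.not_true, Bool.not_false, Bool.toNat_true, Bool.toNat_false]
        at hcard hcard' hbodd <;> [rw [hcard']; skip] <;> omega
  · cases hb : b₀ <;> rw [hb] at hcard hcard' <;>
      simp only [Bool.not_true, Bool.not_false] at hcard hcard' <;> rw [hcard, hcard'] <;> omega

/-- Abandon a single vertex that cannot be extended to a longer path, and start again. -/
theorem restart (S : PathSearch H P C s 0 v U X W) (hPC : ∀ b, Disjoint (P b) C)
    (hPP : ∀ b, Disjoint (P b) (P !b)) (hX : (X false).card < s)
    (hlink : ∀ c ∈ W, ∀ y ∈ U true, ({v 0, c, y} : Finset V) ∉ H) {a : V} (ha : a ∈ U false) :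
    PathSearch H P C s 0 (fun _ => a) (Function.update U false ((U false).erase a))
      (Function.update X false (insert (v 0) (X false))) W := by
  have haP := S.U_subset _ ha
  have hxX : v 0 ∉ X false := S.notMem_X _ le_rfl _
  have hxU : ∀ b, v 0 ∉ U b := S.notMem_U _ le_rfl
  have hxP : v 0 ∈ P false := S.joint 0 le_rfl
  have h1 := S.card_false
  have h2 := S.card_true
  have h3 := S.card_C
  have hcard := Finset.card_erase_add_one ha
  refine ⟨⟨?_, by simp⟩, ?_, by simp, ?_, ?_, ?_, ?_, ?_, S.W_subset, ?_, ?_, ?_, ?_, ?_, ?_⟩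
  · intro i hi j hj _
    simp only [Set.mem_Iio] at hi hj
    omega
  · intro i hi
    obtain rfl : i = 0 := by omega
    exact haP
  · exact fun j _ h => Finset.disjoint_left.1 (hPC _) haP (S.W_subset h)
  · rintro j - (_ | _)
    · simp
    · simpa using fun h => Finset.disjoint_left.1 (hPP false) haP (S.U_subset _ h)
  · rintro j - (_ | _)
    · simp only [Function.update_self, Finset.mem_insert, not_or]
      exact ⟨fun h => hxU _ (h ▸ ha), fun h => Finset.disjoint_left.1 (S.disj _ _) h ha⟩
    · simpa using fun h => Finset.disjoint_left.1 (S.disj _ _) h ha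
  · rintro (_ | _)
    · simpa using (Finset.erase_subset _ _).trans (S.U_subset false)
    · simpa using S.U_subset true
  · rintro (_ | _)
    · simpa [Finset.insert_subset_iff] using ⟨hxP, S.X_subset false⟩
    · simpa using S.X_subset true
  · rintro (_ | _) x hx c hc y hy
    · simp only [Function.update_self, Finset.mem_insert] at hx
      rcases hx with rfl | hx
      · exact hlink c hc y (by simpa using hy)
      · exact S.not_link false x hx c hc y (by simpa using hy)
    · refine S.not_link true x (by simpa using hx) c hc y ?_
      simp only [Bool.not_true, Function.update_self] at hy
      exact Finset.mem_of_mem_erase hy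
  · have hUU : ∀ b, Function.update U false ((U false).erase a) b ⊆ U b := by
      rintro (_ | _)
      · simpa using Finset.erase_subset _ _
      · simp
    intro b b'
    refine Disjoint.mono_right (hUU b') ?_
    cases b
    · simpa [Finset.disjoint_insert_left] using ⟨hxU b', S.disj false b'⟩
    · simpa using S.disj true b'
  · rintro (_ | _)
    · simp [Finset.card_insert_of_notMem hxX]; omega
    · simpa using S.card_X true
  · simp [Finset.card_insert_of_notMem hxX]; omega
  · simpa using h2
  · simp [Finset.card_insert_of_notMem hxX]; omega

theorem exists_terminal (hs : 0 < s) (hPC : ∀ b, Disjoint (P b) C)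
    (hPP : ∀ b, Disjoint (P b) (P !b))
    (hreg : ∀ b, ∀ X ⊆ P b, ∀ W ⊆ C, ∀ Y ⊆ P !b, s ≤ X.card → s ≤ W.card → s ≤ Y.card →
      ∃ x ∈ X, ∃ c ∈ W, ∃ y ∈ Y, ({x, c, y} : Finset V) ∈ H)
    (S : PathSearch H P C s k v U X W) :
    ∃ k v U X W, PathSearch H P C s k v U X W ∧ ((∃ b, (U b).card < s) ∨ W.card < s) := by
  induction hN : (U false).card + (U true).card + W.card + k using Nat.strong_induction_on
    generalizing k v U X W with
  | _ N ih =>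
    by_cases hfin : (∃ b, (U b).card < s) ∨ W.card < s
    · exact ⟨k, v, U, X, W, S, hfin⟩
    push Not at hfin
    have hX := S.card_X_lt hreg hfin.1 hfin.2
    by_cases hlink : ∀ c ∈ W, ∀ y ∈ U !k.bodd, ({v (2 * k), c, y} : Finset V) ∉ H
    · cases k with
      | zero =>
        obtain ⟨a, ha⟩ := Finset.card_pos.1 (hs.trans_le (hfin.1 false))
        have hcard := Finset.card_erase_add_one ha
        refine ih _ ?_ (S.restart hPC hPP (hX _) (by simpa using hlink) ha) rfl
        simp only [Function.update_self, ne_eq, Bool.true_eq_false, not_false_eq_true,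
          Function.update_of_ne]
        omega
      | succ k => exact ih _ (by omega) (S.pop (hX _) hlink) rfl
    · push Not at hlink
      obtain ⟨c, hc, y, hy, he⟩ := hlink
      have hcard := Finset.card_erase_add_one hc
      have hcard' := Finset.card_erase_add_one hy
      refine ih _ ?_ (S.extend hPC hPP hc hy he) rfl
      generalize k.bodd = b at hcard' ⊢
      cases b <;> simp at hcard' ⊢ <;> omega

theorem pathVerts_subset (S : PathSearch H P C s k v U X W) :
    pathVerts k v ⊆ P false ∪ P true ∪ C := by
  intro z hz
  obtain ⟨j, hj, rfl⟩ := Finset.mem_image.1 hz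
  rw [Finset.mem_range] at hj
  rcases Nat.even_or_odd' j with ⟨i, rfl | rfl⟩
  · have := S.joint i (by omega)
    cases h : i.bodd <;> rw [h] at this <;> simp [this]
  · simp [S.mid i (by omega)]

end PathSearch

/-- A lower regular triple whose parts have sizes in proportion `1 : 1 : 2` contains a loose path
covering almost all of it. -/
theorem exists_loosePath {V : Type*} [DecidableEq V] {H : Finset (Finset V)} {s m : ℕ}
    {A B C : Finset V} (hs : 0 < s) (hAB : Disjoint A B) (hAC : Disjoint A C)
    (hBC : Disjoint B C) (hreg : LowerRegular (fun x y z => ({x, y, z} : Finset V) ∈ H) s A B C)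
    (hA : m ≤ A.card) (hB : m ≤ B.card) (hC : 2 * m ≤ C.card) (hne : A.Nonempty) :
    ∃ k v, IsLoosePath H k v ∧ pathVerts k v ⊆ A ∪ B ∪ C ∧ 4 * m ≤ 2 * k + 1 + 8 * s + 4 := by
  obtain ⟨a, ha⟩ := hne
  set P : Bool → Finset V := fun b => cond b B A with hP
  have hPC : ∀ b, Disjoint (P b) C := by rintro (_ | _) <;> assumption
  have hPP : ∀ b, Disjoint (P b) (P !b) := by
    rintro (_ | _)
    · exact hAB
    · exact hAB.symm
  have hregP : ∀ b, ∀ X ⊆ P b, ∀ W ⊆ C, ∀ Y ⊆ P !b, s ≤ X.card → s ≤ W.card → s ≤ Y.card →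
      ∃ x ∈ X, ∃ c ∈ W, ∃ y ∈ Y, ({x, c, y} : Finset V) ∈ H := by
    rintro (_ | _) X hX W hW Y hY h1 h2 h3
    · obtain ⟨x, hx, y, hy, c, hc, he⟩ := hreg X hX Y hY W hW h1 h3 h2
      exact ⟨x, hx, c, hc, y, hy, by rwa [Finset.pair_comm c y]⟩
    · obtain ⟨y, hy, x, hx, c, hc, he⟩ := hreg Y hY X hX W hW h3 h1 h2
      refine ⟨x, hx, c, hc, y, hy, ?_⟩
      rwa [Finset.pair_comm c y, Finset.insert_comm]
  have hinit : PathSearch H P C s 0 (fun _ => a) (Function.update P false (A.erase a))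
      (fun _ => ∅) C := by
    have hcard := Finset.card_erase_add_one ha
    refine ⟨⟨?_, by simp⟩, ?_, by simp, ?_, ?_, by simp, ?_, by simp, subset_rfl, by simp,
      by simp, by simp, ?_, ?_, by simp⟩
    · intro i hi j hj _
      simp only [Set.mem_Iio] at hi hj
      omega
    · intro i hi
      obtain rfl : i = 0 := by omega
      exact ha
    · exact fun j _ h => Finset.disjoint_left.1 hAC ha h
    · rintro j - (_ | _)
      · simp
      · simpa [hP] using fun h => Finset.disjoint_left.1 hAB ha h
    · rintro (_ | _)
      · simpa [hP] using Finset.erase_subset _ _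
      · simp
    · simp [hP]; omega
    · simp [hP]
  obtain ⟨k, v, U, X, W, S, hfin⟩ := PathSearch.exists_terminal hs hPC hPP hregP hinit
  refine ⟨k, v, S.path, S.pathVerts_subset, ?_⟩
  have h1 : A.card ≤ _ := S.card_false
  have h2 : B.card ≤ _ := S.card_true
  have h3 := S.card_C
  have h4 := S.card_X false
  have h5 := S.card_X true
  rcases hfin with ⟨_ | _, h⟩ | h <;> omega

/-- If for every weighting some member of a family of sets carries, up to an error `ρ`, at least
its share of the weight, then members of the family can be chosen one after the other to cover
almost every point almost exactly `D` times. Here `X j v` is the number of times that `v` has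
been covered by the first `j` sets. -/
theorem exists_balanced_cover {V ι : Type*} [Fintype V] [DecidableEq V] (T : ι → Finset V)
    {n D : ℕ} {ρ t : ℝ} (hn : Fintype.card V = n) (hn₀ : 0 < n) (hD : 0 < D) (hρ : 0 ≤ ρ)
    (ht : 0 < t) (hT : ∀ i, t ≤ (T i).card)
    (h : ∀ u : V → ℝ, (∀ x, 0 ≤ u x) → (∀ x, u x ≤ 1) →
      ∃ i, (T i).card * ((∑ x, u x) / n - ρ) ≤ ∑ x ∈ T i, u x) :
    ∃ (K : ℕ) (τ : ℕ → ι) (X : ℕ → V → ℕ), (∀ v, X 0 v = 0) ∧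
      (∀ j v, X (j + 1) v = X j v + if v ∈ T (τ j) then 1 else 0) ∧
      K * t ≤ n * D ∧ ∑ v, X K v ≤ n * D ∧ n * D ≤ ∑ v, X K v + n ∧
      ∑ v, (X K v - D) ≤ ∑ v, (D - X K v) ∧
      ((∑ v, (D - X K v) : ℕ) : ℝ) ^ 2 ≤ n ^ 2 * (1 + D + 2 * ρ * D ^ 2) := by
  have hn' : (0 : ℝ) < n := by exact_mod_cast hn₀
  have hD' : (0 : ℝ) < D := by exact_mod_cast hD
  have hnext : ∀ X : V → ℕ, ∃ i, ((T i).card : ℝ) * ((n * D - ∑ v, (X v : ℝ)) / n - ρ * D) ≤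
      ∑ v ∈ T i, ((D - X v : ℕ) : ℝ) := by
    intro X
    obtain ⟨i, hi⟩ := h (fun v => ((D - X v : ℕ) : ℝ) / D) (fun v => by positivity) (fun v => by
      rw [div_le_one hD']; exact_mod_cast Nat.sub_le _ _)
    refine ⟨i, ?_⟩
    rw [← Finset.sum_div, ← Finset.sum_div, le_div_iff₀ hD'] at hi
    refine le_trans ?_ hi
    have hsum : (n * D - ∑ v, (X v : ℝ)) ≤ ∑ v, ((D - X v : ℕ) : ℝ) := by
      calc (n * D - ∑ v, (X v : ℝ)) = ∑ v, ((D : ℝ) - X v) := by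
            rw [Finset.sum_sub_distrib, Finset.sum_const, Finset.card_univ, hn, nsmul_eq_mul]
        _ ≤ _ := Finset.sum_le_sum fun v _ => by
            rw [sub_le_iff_le_add]; exact_mod_cast le_tsub_add
    rw [mul_assoc]
    refine mul_le_mul_of_nonneg_left ?_ (by positivity)
    rw [sub_mul, div_mul_eq_mul_div, div_mul_cancel₀ _ hD'.ne']
    gcongr
  choose next hnext using hnext
  let X : ℕ → V → ℕ := fun j => Nat.rec (fun _ => 0)
    (fun _ X v => X v + if v ∈ T (next X) then 1 else 0) j
  have hX0 : ∀ v, X 0 v = 0 := fun _ => rfl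
  have hXs : ∀ j v, X (j + 1) v = X j v + if v ∈ T (next (X j)) then 1 else 0 :=
    fun _ _ => rfl
  clear_value X
  have hW0 : ∑ v, X 0 v = 0 := by simp [hX0]
  have hWs : ∀ j, ∑ v, X (j + 1) v = ∑ v, X j v + (T (next (X j))).card := by
    intro j
    simp [hXs, Finset.sum_add_distrib]
  have hcard : ∀ i, (T i).card ≤ n := fun i => hn ▸ Finset.card_le_univ _
  have hWt : ∀ j : ℕ, (j : ℝ) * t ≤ ((∑ v, X j v : ℕ) : ℝ) := by
    intro j
    induction j with
    | zero => simp [hX0]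
    | succ j ih =>
      rw [hWs]
      have := hT (next (X j))
      push_cast at ih ⊢
      linarith
  have hΦ : ∀ j, ∑ v, ((D - X j v : ℕ) : ℝ) ^ 2 ≤
      (n * D - ((∑ v, X j v : ℕ) : ℝ)) ^ 2 / n + (2 * ρ * D + 1) * ((∑ v, X j v : ℕ) : ℝ) := by
    intro j
    induction j with
    | zero =>
      rw [hW0]
      simp only [hX0, tsub_zero, Finset.sum_const, Finset.card_univ, hn, nsmul_eq_mul,
        Nat.cast_zero, mul_zero, add_zero]
      apply le_of_eq
      field_simp
    | succ j ih =>
      set S := T (next (X j)) with hS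
      have hstep : ∑ v, ((D - X (j + 1) v : ℕ) : ℝ) ^ 2 ≤
          ∑ v, ((D - X j v : ℕ) : ℝ) ^ 2 - 2 * ∑ v ∈ S, ((D - X j v : ℕ) : ℝ) + S.card := by
        have : ∀ v, ((D - X (j + 1) v : ℕ) : ℝ) ^ 2 ≤ ((D - X j v : ℕ) : ℝ) ^ 2 -
            2 * (if v ∈ S then ((D - X j v : ℕ) : ℝ) else 0) + if v ∈ S then 1 else 0 := by
          intro v
          rw [hXs]
          by_cases hv : v ∈ S
          · simp only [← hS, hv, if_true]
            rcases Nat.eq_zero_or_pos (D - X j v) with h0 | h0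
            · have : D - (X j v + 1) = 0 := by omega
              rw [this, h0]; simp
            · have : D - X j v = (D - (X j v + 1)) + 1 := by omega
              rw [this]; push_cast; nlinarith
          · simp [← hS, hv]
        refine (Finset.sum_le_sum fun v _ => this v).trans (le_of_eq ?_)
        rw [Finset.sum_add_distrib, Finset.sum_sub_distrib, ← Finset.mul_sum,
          Finset.sum_ite_mem, Finset.univ_inter, Finset.sum_boole]
        simp
      have hgain := hnext (X j)
      rw [hWs, ← hS]
      rw [← hS] at hgain
      push_cast at ih ⊢
      set W : ℝ := ∑ v, (X j v : ℝ)
      set c : ℝ := (S.card : ℝ)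
      have hexp : (n * D - (W + c)) ^ 2 / n =
          (n * D - W) ^ 2 / n - 2 * (c * ((n * D - W) / n)) + c ^ 2 / n := by
        field_simp; ring
      have hpos : 0 ≤ c ^ 2 / n := by positivity
      rw [hexp]
      nlinarith
  have hex : ∃ j, n * D < ∑ v, X j v + n := by
    obtain ⟨j, hj⟩ := exists_nat_gt ((n * D : ℝ) / t)
    refine ⟨j, ?_⟩
    rw [div_lt_iff₀ ht] at hj
    have : n * D < ∑ v, X j v := by exact_mod_cast hj.trans_le (hWt j)
    omega
  classical
  set K := Nat.find hex with hK
  have hK1 : n * D < ∑ v, X K v + n := Nat.find_spec hex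
  have hK2 : ∑ v, X K v ≤ n * D := by
    rcases Nat.eq_zero_or_pos K with h0 | h0
    · rw [h0, hW0]; exact Nat.zero_le _
    · obtain ⟨j, hj⟩ := Nat.exists_eq_add_of_le' h0
      have := Nat.find_min hex (m := j) (by omega)
      rw [hj, hWs]
      have := hcard (next (X j))
      omega
  refine ⟨K, fun j => next (X j), X, hX0, hXs, (hWt K).trans (by exact_mod_cast hK2), hK2,
    hK1.le,
    ?_, ?_⟩
  · have : ∑ v, (X K v + (D - X K v)) = ∑ v : V, (D + (X K v - D)) :=
      Finset.sum_congr rfl fun v _ => by omega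
    rw [Finset.sum_add_distrib, Finset.sum_add_distrib, Finset.sum_const, Finset.card_univ, hn,
      smul_eq_mul] at this
    omega
  · have hcs := sq_sum_le_card_mul_sum_sq (s := Finset.univ)
      (f := fun v => ((D - X K v : ℕ) : ℝ))
    rw [Finset.card_univ, hn] at hcs
    rw [Nat.cast_sum]
    refine hcs.trans ?_
    rw [sq (n : ℝ), mul_assoc]
    refine mul_le_mul_of_nonneg_left ((hΦ K).trans ?_) hn'.le
    have h1 : (n * D : ℝ) < ((∑ v, X K v : ℕ) : ℝ) + n := by exact_mod_cast hK1
    have h2 : ((∑ v, X K v : ℕ) : ℝ) ≤ n * D := by exact_mod_cast hK2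
    set W : ℝ := ((∑ v, X K v : ℕ) : ℝ)
    have h3 : (n * D - W) ^ 2 / n ≤ n := by
      rw [div_le_iff₀ hn']
      nlinarith
    have h4 : (2 * ρ * D + 1) * W ≤ (2 * ρ * D + 1) * (n * D) := by gcongr
    nlinarith

theorem exists_equidistributed_on {V : Type*} [DecidableEq V] (S : Finset V) {D : ℕ}
    (hD : 0 < D) :
    ∃ R : V → ℕ, ∀ i < D, S.card ≤ D * (S.filter fun v => R v = i).card + D := by
  set e := S.equivFin
  refine ⟨fun v => if h : v ∈ S then (e ⟨v, h⟩ : ℕ) % D else 0, fun i hi => ?_⟩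
  have hle : ((Finset.range S.card).filter fun m => m % D = i).card ≤
      (S.filter fun v => (if h : v ∈ S then (e ⟨v, h⟩ : ℕ) % D else 0) = i).card := by
    refine Finset.card_le_card_of_surjOn (fun v => if h : v ∈ S then (e ⟨v, h⟩ : ℕ) else 0) ?_
    intro m hm
    simp only [Finset.coe_filter, Finset.mem_range, Set.mem_ofPred_eq] at hm
    refine ⟨e.symm ⟨m, hm.1⟩, ?_, ?_⟩
    · simp [hm.2]
    · simp
  have hcount := Nat.count_modEq_card S.card hD i
  rw [Nat.count_eq_card_filter_range] at hcount
  have hfilter : ((Finset.range S.card).filter fun m => m ≡ i [MOD D]) =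
      (Finset.range S.card).filter fun m => m % D = i :=
    Finset.filter_congr fun m _ => by rw [Nat.ModEq, Nat.mod_eq_of_lt hi]
  rw [hfilter] at hcount
  have hdiv : S.card / D ≤ (S.filter fun v =>
      (if h : v ∈ S then (e ⟨v, h⟩ : ℕ) % D else 0) = i).card := by omega
  calc S.card ≤ D * (S.card / D) + D := by
        have := Nat.div_add_mod S.card D
        have := Nat.mod_lt S.card hD
        omega
    _ ≤ _ := by gcongr

/-- The vertices can be coloured with `D` colours in such a way that each of finitely many given
sets is split almost evenly. -/
theorem exists_equidistributed {V L : Type*} [DecidableEq V] [Fintype L] [DecidableEq L]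
    (F : L → Finset V) {D : ℕ} (hD : 0 < D) :
    ∃ R : V → ℕ, ∀ l, ∀ i < D,
      (F l).card ≤ D * ((F l).filter fun v => R v = i).card + D * 2 ^ Fintype.card L := by
  set pat : V → Finset L := fun v => Finset.univ.filter fun l => v ∈ F l with hpat
  set U : Finset V := Finset.univ.biUnion F
  choose R hR using fun a : Finset L => exists_equidistributed_on (U.filter fun v => pat v = a) hD
  refine ⟨fun v => R (pat v) v, fun l i hi => ?_⟩
  rw [Finset.card_eq_sum_card_fiberwise (s := F l) (t := Finset.univ) (f := pat)
      (fun _ _ => Finset.mem_coe.2 (Finset.mem_univ _)),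
    Finset.card_eq_sum_card_fiberwise (s := (F l).filter _) (t := Finset.univ) (f := pat)
      (fun _ _ => Finset.mem_coe.2 (Finset.mem_univ _))]
  have hsum : D * 2 ^ Fintype.card L = ∑ _a : Finset L, D := by simp [mul_comm]
  rw [hsum, Finset.mul_sum, ← Finset.sum_add_distrib]
  refine Finset.sum_le_sum fun a _ => ?_
  by_cases hl : l ∈ a
  · have hmem : ∀ v, pat v = a → v ∈ F l := by
      rintro v rfl
      simpa [hpat] using hl
    have h1 : ((F l).filter fun v => pat v = a) = U.filter fun v => pat v = a := by
      ext v
      simp only [Finset.mem_filter, U, Finset.mem_biUnion, Finset.mem_univ, true_and]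
      exact ⟨fun h => ⟨⟨l, h.1⟩, h.2⟩, fun h => ⟨hmem v h.2, h.2⟩⟩
    have h2 : (((F l).filter fun v => R (pat v) v = i).filter fun v => pat v = a) =
        (U.filter fun v => pat v = a).filter fun v => R a v = i := by
      rw [← h1]
      ext v
      simp only [Finset.mem_filter]
      constructor
      · rintro ⟨⟨h, h'⟩, rfl⟩; exact ⟨⟨h, rfl⟩, h'⟩
      · rintro ⟨⟨h, rfl⟩, h'⟩; exact ⟨⟨h, h'⟩, rfl⟩
    rw [h1, h2]
    exact hR a i hi
  · rw [Finset.card_eq_zero.2]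
    · exact Nat.zero_le _
    · rw [Finset.filter_eq_empty_iff]
      rintro v hv rfl
      exact hl (by simpa [hpat] using hv)

theorem card_le_card_slice {V : Type*} [DecidableEq V] {S : Finset V} {D e : ℕ} {y R : V → ℕ}
    (hR : ∀ i < D, (S.filter fun v => y v = i).card ≤
      D * ((S.filter fun v => y v = i).filter fun v => R v = i).card + D * e) :
    S.card ≤ (S.filter fun v => D ≤ y v).card +
      (D * (S.filter fun v => y v = R v).card + D * (D * e)) := by
  have h1 : S.card = (S.filter fun v => D ≤ y v).card + (S.filter fun v => y v < D).card := by
    rw [← Finset.card_filter_add_card_filter_not (fun v => D ≤ y v)]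
    simp only [not_le]
  have h2 : (S.filter fun v => y v < D).card =
      ∑ i ∈ Finset.range D, (S.filter fun v => y v = i).card := by
    rw [Finset.card_eq_sum_card_fiberwise (t := Finset.range D) (f := y)
      (fun v hv => by simpa using (Finset.mem_filter.1 hv).2)]
    refine Finset.sum_congr rfl fun i hi => ?_
    rw [Finset.filter_filter]
    congr 1
    refine Finset.filter_congr fun v _ => ⟨fun h => h.2, fun h => ⟨?_, h⟩⟩
    rw [h]; exact Finset.mem_range.1 hi
  have h3 : ∑ i ∈ Finset.range D,
      ((S.filter fun v => y v = i).filter fun v => R v = i).card ≤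
      (S.filter fun v => y v = R v).card := by
    rw [← Finset.card_biUnion]
    · refine Finset.card_le_card fun v hv => ?_
      simp only [Finset.mem_biUnion, Finset.mem_filter] at hv ⊢
      obtain ⟨i, -, ⟨h, h'⟩, h''⟩ := hv
      exact ⟨h, h'.trans h''.symm⟩
    · intro i _ j _ hij
      rw [Function.onFun, Finset.disjoint_left]
      intro v hv hv'
      simp only [Finset.mem_filter] at hv hv'
      exact hij (hv.2.symm.trans hv'.2)
  rw [h1, h2]
  gcongr
  refine (Finset.sum_le_sum fun i hi => hR i (Finset.mem_range.1 hi)).trans ?_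
  rw [Finset.sum_add_distrib, ← Finset.mul_sum, Finset.sum_const, Finset.card_range, smul_eq_mul]
  gcongr

theorem card_pathVerts {V : Type*} [DecidableEq V] {H : Finset (Finset V)} {k : ℕ} {v : ℕ → V}
    (h : IsLoosePath H k v) : (pathVerts k v).card = 2 * k + 1 := by
  rw [pathVerts, Finset.card_image_of_injOn, Finset.card_range]
  intro i hi j hj hij
  exact h.1 (by simpa using hi) (by simpa using hj) hij

/-- A lower regular triple whose parts have sizes `r * s`, `r * s` and `2 * (r * s)` for some
`s ≥ t`. -/
structure RegularTile {V : Type*} [DecidableEq V] (H : Finset (Finset V)) (r : ℕ) (t : ℝ) where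
  (s : ℕ)
  (A B C : Finset V)
  le_s : t ≤ s
  card_A : A.card = r * s
  card_B : B.card = r * s
  card_C : C.card = 2 * (r * s)
  disjoint_AB : Disjoint A B
  disjoint_AC : Disjoint A C
  disjoint_BC : Disjoint B C
  reg : LowerRegular (fun x y z => ({x, y, z} : Finset V) ∈ H) s A B C

namespace RegularTile

variable {V : Type*} [DecidableEq V] {H : Finset (Finset V)} {r : ℕ} {t : ℝ}

/-- The vertex set of a tile. -/
def verts (T : RegularTile H r t) : Finset V := T.A ∪ T.B ∪ T.C

theorem disjoint_union (T : RegularTile H r t) : Disjoint (T.A ∪ T.B) T.C :=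
  Finset.disjoint_union_left.2 ⟨T.disjoint_AC, T.disjoint_BC⟩

theorem card_verts (T : RegularTile H r t) : T.verts.card = 4 * (r * T.s) := by
  rw [verts, Finset.card_union_of_disjoint T.disjoint_union,
    Finset.card_union_of_disjoint T.disjoint_AB, T.card_A, T.card_B, T.card_C]
  ring

theorem sum_verts (T : RegularTile H r t) (u : V → ℝ) :
    ∑ v ∈ T.verts, u v = ∑ v ∈ T.A, u v + ∑ v ∈ T.B, u v + ∑ v ∈ T.C, u v := by
  rw [verts, Finset.sum_union T.disjoint_union, Finset.sum_union T.disjoint_AB]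

/-- The three parts of a tile. -/
def part (T : RegularTile H r t) : Fin 3 → Finset V := ![T.A, T.B, T.C]

/-- Among the vertices of a tile where `y` and `R` agree, a loose path covers almost its proper
share. -/
theorem exists_path (T : RegularTile H r t) (hs : 0 < T.s) {D e : ℕ} {y R : V → ℕ}
    (hR : ∀ a, ∀ i < D, ((T.part a).filter fun v => y v = i).card ≤
      D * (((T.part a).filter fun v => y v = i).filter fun v => R v = i).card + D * e) :
    ∃ Q : Finset V, (Q = ∅ ∨ ∃ k v, IsLoosePath H k v ∧ Q = pathVerts k v) ∧
      (∀ v ∈ Q, v ∈ T.verts ∧ y v = R v) ∧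
      T.verts.card ≤ 4 * (T.verts.filter fun v => D ≤ y v).card +
        (D * Q.card + (D * (8 * T.s) + (8 * D + 4 * (D * (D * e))))) := by
  set A' := T.A.filter fun v => y v = R v with hA'
  set B' := T.B.filter fun v => y v = R v with hB'
  set C' := T.C.filter fun v => y v = R v with hC'
  set m := min (min A'.card B'.card) (C'.card / 2) with hm
  set x := (T.verts.filter fun v => D ≤ y v).card with hx
  have hsub : ∀ S ⊆ T.verts, (S.filter fun v => D ≤ y v).card ≤ x := fun S hS =>
    Finset.card_le_card (Finset.filter_subset_filter _ hS)
  have hA := card_le_card_slice (hR 0)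
  have hB := card_le_card_slice (hR 1)
  have hC := card_le_card_slice (hR 2)
  simp only [part, Matrix.cons_val] at hA hB hC
  have hxA := hsub T.A (Finset.subset_union_left.trans Finset.subset_union_left)
  have hxB := hsub T.B (Finset.subset_union_right.trans Finset.subset_union_left)
  have hxC := hsub T.C Finset.subset_union_right
  rw [← hA', T.card_A] at hA
  rw [← hB', T.card_B] at hB
  rw [← hC', T.card_C] at hC
  have hmain : 4 * (r * T.s) ≤ 4 * x + (D * (4 * m) + (4 * D + 4 * (D * (D * e)))) := by
    have hm' : m = A'.card ∨ m = B'.card ∨ m = C'.card / 2 := by omega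
    have h2 : D * C'.card ≤ D * (2 * (C'.card / 2) + 1) :=
      Nat.mul_le_mul_left _ (by omega)
    generalize C'.card / 2 = c at h2 hm'
    generalize D * (D * e) = E at hA hB hC ⊢
    rcases hm' with h | h | h <;> rw [h] <;> nlinarith
  have key : ∃ Q : Finset V, (Q = ∅ ∨ ∃ k v, IsLoosePath H k v ∧ Q = pathVerts k v) ∧
      Q ⊆ A' ∪ B' ∪ C' ∧ 4 * m ≤ Q.card + 8 * T.s + 4 := by
    rcases A'.eq_empty_or_nonempty with h0 | h0
    · refine ⟨∅, Or.inl rfl, Finset.empty_subset _, ?_⟩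
      have : A'.card = 0 := by rw [h0, Finset.card_empty]
      omega
    · obtain ⟨k, v, hp, hv, hk⟩ := exists_loosePath (H := H) (m := m)
        (A := A') (B := B') (C := C') hs
        (Finset.disjoint_filter_filter T.disjoint_AB)
        (Finset.disjoint_filter_filter T.disjoint_AC)
        (Finset.disjoint_filter_filter T.disjoint_BC)
        (T.reg.mono (fun _ _ _ h => h) (Finset.filter_subset _ _) (Finset.filter_subset _ _)
          (Finset.filter_subset _ _)) (by omega) (by omega) (by omega) h0
      exact ⟨_, Or.inr ⟨k, v, hp, rfl⟩, hv, by rw [card_pathVerts hp]; omega⟩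
  obtain ⟨Q, hQ, hQs, hQm⟩ := key
  refine ⟨Q, hQ, fun v hv => ?_, ?_⟩
  · have := hQs hv
    simp only [hA', hB', hC', ← Finset.filter_union, Finset.mem_filter] at this
    exact this
  · rw [T.card_verts]
    have := Nat.mul_le_mul_left D hQm
    nlinarith

end RegularTile

section Cover

variable {V : Type*} [DecidableEq V] {X : ℕ → V → ℕ} {T : ℕ → Finset V}

theorem monotone_of_cover
    (hXs : ∀ j v, X (j + 1) v = X j v + if v ∈ T j then 1 else 0) (v : V) :
    Monotone fun j => X j v :=
  monotone_nat_of_le_succ fun j => by rw [hXs]; exact Nat.le_add_right _ _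

/-- Subsets of the members of a cover consisting of vertices whose multiplicity is prescribed are
pairwise disjoint. -/
theorem disjoint_of_cover
    (hXs : ∀ j v, X (j + 1) v = X j v + if v ∈ T j then 1 else 0) {R : V → ℕ}
    {Q : ℕ → Finset V} {i j : ℕ} (hi : ∀ v ∈ Q i, v ∈ T i ∧ X i v = R v)
    (hj : ∀ v ∈ Q j, v ∈ T j ∧ X j v = R v) (hij : i ≠ j) : Disjoint (Q i) (Q j) := by
  wlog h : i < j generalizing i j
  · exact (this hj hi hij.symm (by omega)).symm
  rw [Finset.disjoint_left]
  intro v hvi hvj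
  obtain ⟨h1, h2⟩ := hi v hvi
  obtain ⟨-, h3⟩ := hj v hvj
  have h4 := hXs i v
  rw [if_pos h1] at h4
  have h5 : X (i + 1) v ≤ X j v := monotone_of_cover hXs v h
  omega

theorem sum_card_cover [Fintype V] (hX0 : ∀ v, X 0 v = 0)
    (hXs : ∀ j v, X (j + 1) v = X j v + if v ∈ T j then 1 else 0) (K : ℕ) :
    ∑ j ∈ Finset.range K, (T j).card = ∑ v, X K v := by
  induction K with
  | zero => simp [hX0]
  | succ K ih => simp [Finset.sum_range_succ, ih, hXs, Finset.sum_add_distrib]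

theorem sum_card_excess [Fintype V] (hX0 : ∀ v, X 0 v = 0)
    (hXs : ∀ j v, X (j + 1) v = X j v + if v ∈ T j then 1 else 0) (D K : ℕ) :
    ∑ j ∈ Finset.range K, ((T j).filter fun v => D ≤ X j v).card = ∑ v, (X K v - D) := by
  induction K with
  | zero => simp [hX0]
  | succ K ih =>
    rw [Finset.sum_range_succ, ih]
    have : ∀ v, X (K + 1) v - D = X K v - D + if v ∈ (T K).filter (fun v => D ≤ X K v)
        then 1 else 0 := by
      intro v
      rw [hXs]
      simp only [Finset.mem_filter]
      split_ifs <;> simp_all <;> omega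
    simp only [this, Finset.sum_add_distrib, Finset.sum_boole, Finset.filter_univ_mem,
      Nat.cast_id]

end Cover

/-- Discard the empty sets from a family of vertex sets of loose paths. -/
theorem exists_paths_of_family {V : Type*} [DecidableEq V] {H : Finset (Finset V)} {K : ℕ}
    {Q : ℕ → Finset V}
    (hQ : ∀ j < K, Q j = ∅ ∨ ∃ k v, IsLoosePath H k v ∧ Q j = pathVerts k v)
    (hdisj : ∀ i < K, ∀ j < K, i ≠ j → Disjoint (Q i) (Q j)) :
    ∃ (s : ℕ) (ks : Fin s → ℕ) (vs : Fin s → ℕ → V), s ≤ K ∧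
      (∀ i, IsLoosePath H (ks i) (vs i)) ∧
      (∀ i j, i ≠ j → Disjoint (pathVerts (ks i) (vs i)) (pathVerts (ks j) (vs j))) ∧
      (Finset.range K).biUnion Q = Finset.univ.biUnion fun i => pathVerts (ks i) (vs i) := by
  set J := (Finset.range K).filter fun j => Q j ≠ ∅ with hJ
  set f := J.orderEmbOfFin rfl with hf
  have hfJ : ∀ i, f i < K ∧ Q (f i) ≠ ∅ := fun i => by
    have : f i ∈ J := J.orderEmbOfFin_mem rfl i
    exact ⟨Finset.mem_range.1 (Finset.mem_filter.1 this).1, (Finset.mem_filter.1 this).2⟩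
  have hpath : ∀ i, ∃ k v, IsLoosePath H k v ∧ Q (f i) = pathVerts k v := fun i =>
    (hQ _ (hfJ i).1).resolve_left (hfJ i).2
  choose ks vs hp hv using hpath
  refine ⟨J.card, ks, vs, ?_, hp, ?_, ?_⟩
  · simpa using Finset.card_filter_le (Finset.range K) fun j => Q j ≠ ∅
  · intro i j hij
    rw [← hv, ← hv]
    exact hdisj _ (hfJ i).1 _ (hfJ j).1 (f.injective.ne hij)
  · ext x
    simp only [Finset.mem_biUnion, Finset.mem_range, Finset.mem_univ, true_and, ← hv]
    constructor
    · rintro ⟨j, hj, hx⟩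
      have hjJ : j ∈ J := by
        rw [hJ, Finset.mem_filter, Finset.mem_range]
        exact ⟨hj, fun h => by simp [h] at hx⟩
      have : j ∈ Set.range f := by rw [hf, Finset.range_orderEmbOfFin]; exact hjJ
      obtain ⟨i, rfl⟩ := this
      exact ⟨i, hx⟩
    · rintro ⟨i, hx⟩
      exact ⟨f i, (hfJ i).1, hx⟩

/-- If every weighting admits a regular tile of at least average weight, up to an error `ρ`, then
almost all vertices can be covered by few vertex-disjoint loose paths. -/
theorem exists_path_family {V : Type*} [Fintype V] [DecidableEq V] {H : Finset (Finset V)}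
    {n D r : ℕ} {ρ t : ℝ} (hn : Fintype.card V = n) (hn₀ : 0 < n) (hD : 0 < D) (hρ : 0 ≤ ρ)
    (ht : 0 < t) (hr : 0 < r)
    (h : ∀ u : V → ℝ, (∀ x, 0 ≤ u x) → (∀ x, u x ≤ 1) → ∃ T : RegularTile H r t,
      4 * (r * T.s : ℝ) * ((∑ x, u x) / n - ρ) ≤ ∑ x ∈ T.verts, u x) :
    ∃ (K : ℕ) (Q : ℕ → Finset V) (x : ℕ), K * (4 * (r * t)) ≤ n * D ∧
      (∀ j < K, Q j = ∅ ∨ ∃ k v, IsLoosePath H k v ∧ Q j = pathVerts k v) ∧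
      (∀ i < K, ∀ j < K, i ≠ j → Disjoint (Q i) (Q j)) ∧
      (x : ℝ) ^ 2 ≤ n ^ 2 * (1 + D + 2 * ρ * D ^ 2) ∧
      r * (n * D) ≤ r * n + r * (4 * x) + r * (D * ((Finset.range K).biUnion Q).card) +
        2 * (n * D ^ 2) + r * (K * (8 * D + 4 * (D * (D * 2 ^ (K * (3 * D)))))) := by
  have hcardT : ∀ T : RegularTile H r t, (T.verts.card : ℝ) = 4 * (r * T.s) := fun T => by
    rw [T.card_verts]; push_cast; ring
  have hr' : (0 : ℝ) < r := by exact_mod_cast hr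
  obtain ⟨K, τ, X, hX0, hXs, hKt, hWD, hW, hexc, hsq⟩ :=
    exists_balanced_cover (ι := RegularTile H r t) RegularTile.verts hn hn₀ hD hρ
      (t := 4 * (r * t)) (by positivity)
      (fun T => by rw [hcardT]; have := T.le_s; gcongr)
      (fun u h0 h1 => by simpa only [hcardT] using h u h0 h1)
  obtain ⟨R, hR⟩ := exists_equidistributed
    (fun l : Fin K × Fin 3 × Fin D => ((τ l.1).part l.2.1).filter fun v => X l.1 v = l.2.2) hD
  have hcardL : Fintype.card (Fin K × Fin 3 × Fin D) = K * (3 * D) := by simp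
  rw [hcardL] at hR
  set e := 2 ^ (K * (3 * D)) with he
  have hpath : ∀ j, ∃ Q : Finset V, j < K →
      (Q = ∅ ∨ ∃ k v, IsLoosePath H k v ∧ Q = pathVerts k v) ∧
      (∀ v ∈ Q, v ∈ (τ j).verts ∧ X j v = R v) ∧
      (τ j).verts.card ≤ 4 * ((τ j).verts.filter fun v => D ≤ X j v).card +
        (D * Q.card + (D * (8 * (τ j).s) + (8 * D + 4 * (D * (D * e))))) := by
    intro j
    by_cases hj : j < K
    · obtain ⟨Q, hQ⟩ := (τ j).exists_path (D := D) (e := e) (y := X j) (R := R)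
        (by exact_mod_cast ht.trans_le (τ j).le_s)
        (fun a i hi => hR (⟨j, hj⟩, a, ⟨i, hi⟩) i hi)
      exact ⟨Q, fun _ => hQ⟩
    · exact ⟨∅, fun h => absurd h hj⟩
  choose Q hQ using hpath
  have hdisj : ∀ i < K, ∀ j < K, i ≠ j → Disjoint (Q i) (Q j) := fun i hi j hj hij =>
    disjoint_of_cover hXs (hQ i hi).2.1 (hQ j hj).2.1 hij
  refine ⟨K, Q, ∑ v, (D - X K v), hKt, fun j hj => (hQ j hj).1, hdisj, hsq, ?_⟩
  have hsum := Finset.sum_le_sum fun j hj => (hQ j (Finset.mem_range.1 hj)).2.2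
  simp only [Finset.sum_add_distrib, ← Finset.mul_sum] at hsum
  rw [sum_card_cover hX0 hXs, sum_card_excess hX0 hXs] at hsum
  rw [Finset.card_biUnion fun i hi j hj => hdisj i (Finset.mem_range.1 hi) j
    (Finset.mem_range.1 hj)]
  have hs : r * (4 * ∑ j ∈ Finset.range K, (τ j).s) = ∑ v, X K v := by
    rw [← sum_card_cover hX0 hXs, Finset.mul_sum, Finset.mul_sum]
    exact Finset.sum_congr rfl fun j _ => by rw [RegularTile.card_verts]; ring
  simp only [Finset.sum_const, Finset.card_range, smul_eq_mul] at hsum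
  set c := ∑ j ∈ Finset.range K, (Q j).card
  set S := ∑ j ∈ Finset.range K, (τ j).s
  set W := ∑ v, X K v
  have h1 := Nat.mul_le_mul_left r hsum
  have h2 := Nat.mul_le_mul_left r hW
  have h3 := Nat.mul_le_mul_left (4 * r) hexc
  have h4 := Nat.mul_le_mul_left (2 * D) hWD
  rw [← hs] at h4
  generalize ∑ v, (D - X K v) = x at h3 ⊢
  generalize ∑ v, (X K v - D) = x' at h1 h3
  rw [← he]
  clear_value e c S W
  linarith only [h1, h2, h3, h4]

/-- Path-tiling Lemma: under minimum vertex degree `(7/16 - γ₃) C(n,2)`, either at most `p`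
vertex-disjoint loose paths cover all but at most `α n` vertices, or `H` is
`2050 γ₃`-extremal. -/
theorem stmt_9 (γ₃ α : ℝ) (hγ₀ : 0 < γ₃) (hγ₁ : γ₃ < 1) (hα₀ : 0 < α) (hα₁ : α < 1) :
    ∃ p n₀ : ℕ, ∀ n : ℕ, n > n₀ →
      ∀ H : Finset (Finset (Fin n)), (∀ e ∈ H, e.card = 3) →
      (∀ x : Fin n, (7 / 16 - γ₃) * (n.choose 2 : ℝ) ≤ (hdeg H x : ℝ)) →
      (∃ (s : ℕ) (ks : Fin s → ℕ) (vs : Fin s → ℕ → Fin n),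
        s ≤ p ∧
        (∀ i, IsLoosePath H (ks i) (vs i)) ∧
        (∀ i j, i ≠ j → Disjoint (pathVerts (ks i) (vs i)) (pathVerts (ks j) (vs j))) ∧
        (((Finset.univ \ Finset.univ.biUnion
            (fun i => pathVerts (ks i) (vs i))).card : ℝ) ≤ α * n)) ∨
      BetaExtremal (2050 * γ₃) n H := by
  set ρ : ℝ := α ^ 2 / 1024 with hρdef
  have hρ : 0 < ρ := by positivity
  have hρ1 : ρ ≤ 1 / 2 := by rw [hρdef]; nlinarith
  obtain ⟨D, hDα⟩ := exists_nat_ge (1024 / α ^ 2)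
  rw [div_le_iff₀ (by positivity)] at hDα
  have hD : 0 < D := by
    rw [Nat.pos_iff_ne_zero]
    intro h
    rw [h] at hDα
    norm_num at hDα
  have hD' : (1 : ℝ) ≤ D := by exact_mod_cast hD
  obtain ⟨r, hrmax⟩ := exists_nat_ge (max (2 / ρ) (8 * D / α))
  have hr : 2 / ρ ≤ r := (le_max_left _ _).trans hrmax
  have hrD : 8 * D ≤ r * α := by
    rw [← div_le_iff₀ hα₀]
    exact (le_max_right _ _).trans hrmax
  have hr' : (0 : ℝ) < r := lt_of_lt_of_le (by positivity) hr
  have hr₀ : 0 < r := by exact_mod_cast hr'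
  obtain ⟨c, hc, n₁, htile⟩ := exists_tile hγ₀ hρ hρ1 hr
  obtain ⟨M, hM⟩ := exists_nat_ge (D / (4 * (r * c)))
  obtain ⟨n₂, hn₂⟩ := exists_nat_ge (M * (32 + 16 * (D * 2 ^ (M * (3 * D)))) / α)
  refine ⟨M, max n₁ n₂, fun n hn H hH hdeg => ?_⟩
  by_cases hext : BetaExtremal (2050 * γ₃) n H
  · exact Or.inr hext
  left
  have hn₀ : 0 < n := by omega
  have hn' : (0 : ℝ) < n := by exact_mod_cast hn₀
  have htiles : ∀ u : Fin n → ℝ, (∀ x, 0 ≤ u x) → (∀ x, u x ≤ 1) →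
      ∃ T : RegularTile H r (c * n),
        4 * (r * T.s : ℝ) * ((∑ x, u x) / n - ρ) ≤ ∑ x ∈ T.verts, u x := by
    intro u h0 h1
    obtain ⟨s, A, B, C, hs, hA, hB, hC, hAB, hAC, hBC, hreg, hu⟩ :=
      htile n ((le_max_left _ _).trans_lt hn) H hH hdeg hext u h0 h1
    refine ⟨⟨s, A, B, C, hs, hA, hB, hC, hAB, hAC, hBC, hreg⟩, ?_⟩
    rwa [RegularTile.sum_verts]
  obtain ⟨K, Q, x, hK, hQ, hdisj, hx, hcover⟩ := exists_path_family (Fintype.card_fin n) hn₀ hD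
    hρ.le (mul_pos hc hn') hr₀ htiles
  have hKM : K ≤ M := by
    have h1 : (K : ℝ) ≤ D / (4 * (r * c)) := by
      rw [le_div_iff₀ (by positivity)]
      nlinarith
    exact_mod_cast h1.trans hM
  obtain ⟨s, ks, vs, hs, hp, hd, hU⟩ := exists_paths_of_family hQ hdisj
  refine ⟨s, ks, vs, hs.trans hKM, hp, hd, ?_⟩
  rw [← hU]
  set m := ((Finset.range K).biUnion Q).card
  have hcard : ((Finset.univ \ (Finset.range K).biUnion Q).card : ℝ) = n - m := by
    rw [Finset.card_sdiff_of_subset (Finset.subset_univ _), Finset.card_univ, Fintype.card_fin,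
      Nat.cast_sub (by simpa using Finset.card_le_univ ((Finset.range K).biUnion Q))]
  rw [hcard]
  have hx' : 16 * (x : ℝ) ≤ n * (D * α) := by
    refine abs_le_of_sq_le_sq' ?_ (by positivity) |>.2
    have : 256 * (1 + D + 2 * ρ * D ^ 2) ≤ (D * α) ^ 2 := by
      rw [hρdef]
      nlinarith [mul_le_mul_of_nonneg_left hDα (by positivity : (0 : ℝ) ≤ D)]
    calc (16 * (x : ℝ)) ^ 2 = 256 * (x : ℝ) ^ 2 := by ring
      _ ≤ 256 * (n ^ 2 * (1 + D + 2 * ρ * D ^ 2)) := by gcongr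
      _ = n ^ 2 * (256 * (1 + D + 2 * ρ * D ^ 2)) := by ring
      _ ≤ n ^ 2 * (D * α) ^ 2 := by gcongr
      _ = (n * (D * α)) ^ 2 := by ring
  have h1 : 4 * (n : ℝ) ≤ n * (D * α) := by
    have : 4 ≤ D * α := by nlinarith
    nlinarith
  have h2 : 8 * (n * (D : ℝ) ^ 2) ≤ r * (n * (D * α)) := by
    have := mul_le_mul_of_nonneg_left hrD (by positivity : (0 : ℝ) ≤ n * D)
    linarith
  have h3 : 4 * ((K : ℝ) * (8 * D + 4 * (D * (D * 2 ^ (K * (3 * D)))))) ≤ n * (D * α) := by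
    have hnn : M * (32 + 16 * (D * 2 ^ (M * (3 * D)))) ≤ n * α := by
      rw [← div_le_iff₀ hα₀]
      refine hn₂.trans ?_
      exact_mod_cast ((le_max_right _ _).trans_lt hn).le
    have hmono : (K : ℝ) * (32 + 16 * (D * 2 ^ (K * (3 * D)))) ≤
        M * (32 + 16 * (D * 2 ^ (M * (3 * D)))) := by
      gcongr
      norm_num
    have := mul_le_mul_of_nonneg_left (hmono.trans hnn) (by positivity : (0 : ℝ) ≤ D)
    linarith
  have hcover' : (r : ℝ) * (n * D) ≤ r * n + r * (4 * x) + r * (D * m) + 2 * (n * D ^ 2) +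
      r * (K * (8 * D + 4 * (D * (D * 2 ^ (K * (3 * D)))))) := by exact_mod_cast hcover
  have hfinal : (r * D : ℝ) * (n - m) ≤ (r * D) * (α * n) := by
    have e1 := mul_le_mul_of_nonneg_left h1 hr'.le
    have e2 := mul_le_mul_of_nonneg_left hx' hr'.le
    have e3 := mul_le_mul_of_nonneg_left h3 hr'.le
    linarith
  exact le_of_mul_le_mul_left hfinal (by positivity)
end
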